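/- arXiv:2306.15239 — 7 statements merged into one kernel-verified Lean document; each statement's English description precedes it below -/
import Mathlib

section
/- Let d ∈ ℕ, 1 < q < ∞ and 1 < p ≤ u < ∞. Then there exists a constant c > 0 such that for every sequence (f_j)_{j=0}^∞ of locally integrable functions on ℝ^d one has ‖(Σ_{j=0}^∞ (M f_j)(·)^q)^{1/q} | M^u_p(ℝ^d)‖ ≤ c · ‖(Σ_{j=0}^∞ |f_j(·)|^q)^{1/q} | M^u_p(ℝ^d)‖, where (M f)(x) := sup_{r>0} |B(x,r)|^{-1} ∫_{B(x,r)} |f(y)| dy is the Hardy–Littlewood maximal function. -/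
open MeasureTheory ENNReal Set Metric Filter
open scoped NNReal Topology

noncomputable section

abbrev Euc (d : ℕ) : Type := EuclideanSpace ℝ (Fin d)

/-- Morrey quasi-norm of an `ℝ≥0∞`-valued function on a set `Ω ⊆ ℝ^d`. -/
noncomputable def morreyNormE (d : ℕ) (p u : ℝ) (Ω : Set (Euc d)) (g : Euc d → ℝ≥0∞) : ℝ≥0∞ :=
  ⨆ (y : Euc d) (_ : y ∈ Ω) (r : ℝ) (_ : 0 < r),
    ENNReal.ofReal (r ^ ((d : ℝ) * (1 / u - 1 / p))) *
      (∫⁻ x in Ω ∩ Metric.ball y r, g x ^ p) ^ (1 / p)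

/-- Morrey quasi-norm of a complex-valued function on `Ω ⊆ ℝ^d`. -/
noncomputable def morreyNorm (d : ℕ) (p u : ℝ) (Ω : Set (Euc d)) (f : Euc d → ℂ) : ℝ≥0∞ :=
  morreyNormE d p u Ω fun x => (‖f x‖₊ : ℝ≥0∞)

/-- The set of (functions induced by) complex polynomials in `d` variables of
total degree at most `N - 1`, i.e. of total degree `< N`. -/
def polyFuns (d N : ℕ) : Set (Euc d → ℂ) :=
  {P | ∃ Q : MvPolynomial (Fin d) ℂ, Q.totalDegree < N ∧
        ∀ x : Euc d, P x = MvPolynomial.eval (fun i => ((x i : ℝ) : ℂ)) Q}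

/-- Local oscillation `osc_{v,Ω}^{N-1} f (x, t)`. -/
noncomputable def osc (d N : ℕ) (v : ℝ) (Ω : Set (Euc d)) (f : Euc d → ℂ)
    (x : Euc d) (t : ℝ) : ℝ≥0∞ :=
  ⨅ (P : Euc d → ℂ) (_ : P ∈ polyFuns d N),
    (ENNReal.ofReal (t ^ (-(d : ℝ))) *
      ∫⁻ y in Metric.ball x t ∩ Ω, (‖f y - P y‖₊ : ℝ≥0∞) ^ v) ^ (1 / v)

/-- `f` is locally `v`-integrable on `Ω`. -/
def MemLvLoc (d : ℕ) (v : ℝ) (Ω : Set (Euc d)) (f : Euc d → ℂ) : Prop :=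
  AEMeasurable f (volume.restrict Ω) ∧
    ∀ K : Set (Euc d), IsCompact K → K ⊆ Ω → (∫⁻ y in K, (‖f y‖₊ : ℝ≥0∞) ^ v) < ⊤

/-- The `N`-th order difference `Δ_h^N f (x)`. -/
noncomputable def deltaN (d N : ℕ) (f : Euc d → ℂ) (h x : Euc d) : ℂ :=
  ∑ k ∈ Finset.range (N + 1), (-1 : ℂ) ^ (N - k) * (N.choose k : ℂ) * f (x + (k : ℝ) • h)

/-- The set `V^N(x,t)` of admissible difference steps. -/
def VN (d N : ℕ) (Ω : Set (Euc d)) (x : Euc d) (t : ℝ) : Set (Euc d) :=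
  {h | ‖h‖ < t ∧ ∀ ℓ : ℕ, ℓ ≤ N → x + (ℓ : ℝ) • h ∈ Ω}

/-- The Hardy–Littlewood maximal function. -/
noncomputable def hlMaximal (d : ℕ) (f : Euc d → ℂ) (x : Euc d) : ℝ≥0∞ :=
  ⨆ (r : ℝ) (_ : 0 < r),
    (volume (Metric.ball x r))⁻¹ * ∫⁻ y in Metric.ball x r, (‖f y‖₊ : ℝ≥0∞)

/-- The inner product `⟨f,g⟩_{x,t} = t^{-d} ∫_{B(x,t) ∩ Ω} f(z) conj(g(z)) dz`. -/
noncomputable def innerXT (d : ℕ) (Ω : Set (Euc d)) (x : Euc d) (t : ℝ)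
    (f g : Euc d → ℂ) : ℂ :=
  ((t ^ (-(d : ℝ)) : ℝ) : ℂ) * ∫ z in Metric.ball x t ∩ Ω, f z * (starRingEnd ℂ) (g z)

/-- The centred Hardy–Littlewood maximal function of a nonnegative function. -/
def maxFn {d : ℕ} (g : Euc d → ℝ≥0∞) (x : Euc d) : ℝ≥0∞ :=
  ⨆ (r : ℝ) (_ : 0 < r), (volume (ball x r))⁻¹ * ∫⁻ y in ball x r, g y

section WeakType

variable {d : ℕ} {μ : Measure (Euc d)} {D : ℝ≥0∞}

theorem measure_le_of_ball_average
    (hdoub : ∀ x r, 0 < r → μ (closedBall x (5 * r)) ≤ D * μ (ball x r))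
    {g : Euc d → ℝ≥0∞} {t : ℝ≥0∞} {s : Set (Euc d)}
    (hs : ∀ x ∈ s, ∃ r, 0 < r ∧ t * μ (ball x r) ≤ ∫⁻ y in ball x r, g y ∂μ) :
    t * μ s ≤ D * ∫⁻ y, g y ∂μ := by
  choose! ρ hρ0 hρ using hs
  let S : ℕ → Set (Euc d) := fun n => {x | x ∈ s ∧ ρ x ≤ n}
  have hmono : Monotone S := fun m n hmn x hx => ⟨hx.1, hx.2.trans (by exact_mod_cast hmn)⟩
  have hU : s = ⋃ n, S n := by
    ext x
    simp only [S, mem_iUnion, mem_ofPred_eq]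
    exact ⟨fun hx => (exists_nat_ge (ρ x)).imp fun n hn => ⟨hx, hn⟩, fun ⟨n, hn⟩ => hn.1⟩
  rw [hU, hmono.measure_iUnion, ENNReal.mul_iSup]
  refine iSup_le fun n => ?_
  obtain ⟨v, hvS, hdisj, hcov⟩ := Vitali.exists_disjoint_subfamily_covering_enlargement_closedBall
    (S n) (fun x => x) ρ n (fun a ha => ha.2) 5 (by norm_num)
  have hdisj' : v.PairwiseDisjoint fun a => ball a (ρ a) :=
    hdisj.mono fun a => ball_subset_closedBall
  have hcount : v.Countable := hdisj'.countable_of_isOpen (fun _ _ => isOpen_ball)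
    fun a ha => nonempty_ball.2 (hρ0 a (hvS ha).1)
  have hsub : S n ⊆ ⋃ b ∈ v, closedBall b (5 * ρ b) := fun a ha => by
    obtain ⟨b, hb, hab⟩ := hcov a ha
    exact mem_biUnion hb (hab (mem_closedBall_self (hρ0 a ha.1).le))
  calc t * μ (S n) ≤ t * ∑' b : v, μ (closedBall (b : Euc d) (5 * ρ b)) := by
        gcongr
        exact (measure_mono hsub).trans (measure_biUnion_le μ hcount _)
    _ ≤ t * ∑' b : v, D * μ (ball (b : Euc d) (ρ b)) := by
        gcongr with b
        exact hdoub _ _ (hρ0 _ (hvS b.2).1)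
    _ = D * ∑' b : v, t * μ (ball (b : Euc d) (ρ b)) := by
        rw [ENNReal.tsum_mul_left, ENNReal.tsum_mul_left]
        ring
    _ ≤ D * ∑' b : v, ∫⁻ y in ball (b : Euc d) (ρ b), g y ∂μ := by
        gcongr with b
        exact hρ _ (hvS b.2).1
    _ = D * ∫⁻ y in ⋃ b ∈ v, ball b (ρ b), g y ∂μ := by
        rw [lintegral_biUnion hcount (fun _ _ => measurableSet_ball) hdisj']
    _ ≤ D * ∫⁻ y, g y ∂μ := by
        gcongr
        exact Measure.restrict_le_self

theorem lintegral_Ioi_rpow_indicator {a : ℝ} (ha : 0 < a) (t : ℝ≥0∞) :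
    ∫⁻ l in Ioi (0 : ℝ), {l : ℝ | ENNReal.ofReal l < t}.indicator
      (fun l => ENNReal.ofReal (l ^ (a - 1))) l = t ^ a / ENNReal.ofReal a := by
  have key : ∀ b : ℝ, 0 ≤ b → ∫⁻ l in Ioo (0 : ℝ) b, ENNReal.ofReal (l ^ (a - 1)) =
      ENNReal.ofReal b ^ a / ENNReal.ofReal a := fun b hb => by
    have hi : IntervalIntegrable (fun l : ℝ => l ^ (a - 1)) volume 0 b :=
      intervalIntegral.intervalIntegrable_rpow' (by linarith)
    rw [intervalIntegrable_iff_integrableOn_Ioo_of_le hb] at hi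
    rw [← ofReal_integral_eq_lintegral_ofReal hi, ← integral_Ioc_eq_integral_Ioo,
      ← intervalIntegral.integral_of_le hb, integral_rpow (Or.inl (by linarith)),
      sub_add_cancel, Real.zero_rpow ha.ne', sub_zero, ENNReal.ofReal_div_of_pos ha,
      ENNReal.ofReal_rpow_of_nonneg hb ha.le]
    filter_upwards [ae_restrict_mem measurableSet_Ioo] with l hl using Real.rpow_nonneg hl.1.le _
  have hmeas : ∀ t : ℝ≥0∞, MeasurableSet {l : ℝ | ENNReal.ofReal l < t} := fun t =>
    measurableSet_lt ENNReal.measurable_ofReal measurable_const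
  rw [lintegral_indicator (hmeas t), Measure.restrict_restrict (hmeas t)]
  rcases eq_or_ne t ∞ with rfl | ht
  · rw [ENNReal.top_rpow_of_pos ha, ENNReal.top_div_of_ne_top ENNReal.ofReal_ne_top, eq_top_iff]
    refine le_of_tendsto' (x := atTop) (f := fun n : ℕ => ENNReal.ofReal n ^ a / ENNReal.ofReal a)
      ?_ fun n => ?_
    · have h1 : Tendsto (fun n : ℕ => ENNReal.ofReal n ^ a) atTop (𝓝 ∞) := by
        have := (ENNReal.continuous_rpow_const (y := a)).tendsto ∞
        rw [ENNReal.top_rpow_of_pos ha] at this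
        refine this.comp ?_
        simpa using ENNReal.tendsto_nat_nhds_top
      have := ENNReal.Tendsto.div_const h1 (b := ENNReal.ofReal a) (Or.inl (by simp))
      rwa [ENNReal.top_div_of_ne_top ENNReal.ofReal_ne_top] at this
    · rw [← key n n.cast_nonneg]
      exact lintegral_mono_set fun l hl => ⟨by simp, hl.1⟩
  · rw [show {l : ℝ | ENNReal.ofReal l < t} ∩ Ioi 0 = Ioo 0 t.toReal by
      ext l
      simp only [mem_inter_iff, mem_ofPred_eq, mem_Ioi, mem_Ioo]
      constructor
      · rintro ⟨h, h0⟩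
        exact ⟨h0, (ENNReal.ofReal_lt_iff_lt_toReal h0.le ht).1 h⟩
      · rintro ⟨h0, h⟩
        exact ⟨(ENNReal.ofReal_lt_iff_lt_toReal h0.le ht).2 h, h0⟩, key _ ENNReal.toReal_nonneg,
      ENNReal.ofReal_toReal ht]

/-- Marcinkiewicz interpolation between the weak `(1,1)` bound and the trivial `L^∞` bound. -/
theorem lintegral_rpow_le_of_ball_average [SFinite μ] {q : ℝ} (hq : 1 < q)
    (hdoub : ∀ x r, 0 < r → μ (closedBall x (5 * r)) ≤ D * μ (ball x r))
    (hfin : ∀ x r, μ (ball x r) ≠ ∞)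
    {φ g : Euc d → ℝ≥0∞} (hφ : Measurable φ) (hg : Measurable g)
    (h : ∀ x t, t < φ x → ∃ r, 0 < r ∧ t * μ (ball x r) ≤ ∫⁻ y in ball x r, g y ∂μ) :
    ∫⁻ x, φ x ^ q ∂μ ≤
      ENNReal.ofReal q * (2 * D * (2 ^ (q - 1) / ENNReal.ofReal (q - 1))) * ∫⁻ x, g x ^ q ∂μ := by
  have hq0 : 0 < q := by linarith
  have hweak : ∀ l : ℝ, 0 < l → μ {x | ENNReal.ofReal l < φ x} ≤
      2 * D * (ENNReal.ofReal l)⁻¹ * ∫⁻ y, {y | ENNReal.ofReal l < 2 * g y}.indicator g y ∂μ := by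
    intro l hl
    set t := ENNReal.ofReal l with ht
    have ht0 : t ≠ 0 := by simpa [t] using hl
    have htt : t ≠ ∞ := ENNReal.ofReal_ne_top
    have hset : MeasurableSet {y | t < 2 * g y} :=
      measurableSet_lt measurable_const (hg.const_mul 2)
    have := measure_le_of_ball_average (μ := μ) (g := {y | t < 2 * g y}.indicator g) (t := t / 2)
      (s := {x | t < φ x}) hdoub ?_
    · calc μ {x | t < φ x} = 2 * t⁻¹ * (t / 2 * μ {x | t < φ x}) := by
            rw [← mul_assoc, show 2 * t⁻¹ * (t / 2) = 1 from ?_, one_mul]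
            calc 2 * t⁻¹ * (t / 2) = 2 * 2⁻¹ * (t⁻¹ * t) := by rw [div_eq_mul_inv]; ring
              _ = 1 := by
                rw [ENNReal.inv_mul_cancel ht0 htt, ENNReal.mul_inv_cancel (by simp) (by simp), one_mul]
        _ ≤ 2 * t⁻¹ * (D * ∫⁻ y, {y | t < 2 * g y}.indicator g y ∂μ) := by gcongr
        _ = _ := by ring
    · intro x hx
      obtain ⟨r, hr, hxr⟩ := h x t hx
      refine ⟨r, hr, ?_⟩
      have h1 : ∫⁻ y in ball x r, g y ∂μ ≤
          ∫⁻ y in ball x r, {y | t < 2 * g y}.indicator g y ∂μ + t / 2 * μ (ball x r) := by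
        rw [← setLIntegral_const, ← lintegral_add_right _ measurable_const]
        refine lintegral_mono fun y => ?_
        by_cases hy : t < 2 * g y
        · simp [indicator, hy]
        · simp only [indicator, mem_ofPred_eq, hy, if_false, zero_add]
          rw [ENNReal.le_div_iff_mul_le (by simp) (by simp), mul_comm]
          exact not_lt.1 hy
      have h2 : t * μ (ball x r) = t / 2 * μ (ball x r) + t / 2 * μ (ball x r) := by
        rw [← add_mul, ENNReal.add_halves]
      have h3 : t / 2 * μ (ball x r) ≠ ∞ :=
        ENNReal.mul_ne_top (ENNReal.div_ne_top htt (by simp)) (hfin x r)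
      rw [h2] at hxr
      exact (ENNReal.add_le_add_iff_right h3).1 (hxr.trans h1)
  have hmeas1 : MeasurableSet {z : Euc d × ℝ | ENNReal.ofReal z.2 < φ z.1} :=
    measurableSet_lt (ENNReal.measurable_ofReal.comp measurable_snd) (hφ.comp measurable_fst)
  have hmeas2 : MeasurableSet {z : ℝ × Euc d | ENNReal.ofReal z.1 < 2 * g z.2} :=
    measurableSet_lt (ENNReal.measurable_ofReal.comp measurable_fst)
      ((hg.comp measurable_snd).const_mul 2)
  have hpow : ∀ (t : ℝ≥0∞) {a : ℝ}, 0 < a → t ^ a = ENNReal.ofReal a *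
      ∫⁻ l in Ioi (0 : ℝ), {l : ℝ | ENNReal.ofReal l < t}.indicator
      (fun l => ENNReal.ofReal (l ^ (a - 1))) l := fun t a ha => by
    rw [lintegral_Ioi_rpow_indicator ha, ENNReal.mul_div_cancel (by simpa using ha)
      ENNReal.ofReal_ne_top]
  have hpm : ∀ a : ℝ, Measurable fun l : ℝ => ENNReal.ofReal (l ^ a) := fun a => by fun_prop
  calc ∫⁻ x, φ x ^ q ∂μ
      = ENNReal.ofReal q * ∫⁻ x, (∫⁻ l in Ioi (0 : ℝ), {l : ℝ | ENNReal.ofReal l < φ x}.indicator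
        (fun l => ENNReal.ofReal (l ^ (q - 1))) l) ∂μ := by
        rw [← lintegral_const_mul' _ _ ENNReal.ofReal_ne_top]
        exact lintegral_congr fun x => hpow (φ x) hq0
    _ = ENNReal.ofReal q * ∫⁻ l in Ioi (0 : ℝ), ∫⁻ x, {l : ℝ | ENNReal.ofReal l < φ x}.indicator
        (fun l => ENNReal.ofReal (l ^ (q - 1))) l ∂μ := by
        rw [lintegral_lintegral_swap]
        exact (((hpm (q - 1)).comp measurable_snd).indicator hmeas1).aemeasurable
    _ = ENNReal.ofReal q * ∫⁻ l in Ioi (0 : ℝ),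
        ENNReal.ofReal (l ^ (q - 1)) * μ {x | ENNReal.ofReal l < φ x} := by
        congr 1
        refine lintegral_congr fun l => ?_
        rw [← lintegral_indicator_const (measurableSet_lt measurable_const hφ)]
        rfl
    _ ≤ ENNReal.ofReal q * ∫⁻ l in Ioi (0 : ℝ), 2 * D * ∫⁻ y,
        {l : ℝ | ENNReal.ofReal l < 2 * g y}.indicator
        (fun l => ENNReal.ofReal (l ^ (q - 1 - 1))) l * g y ∂μ := by
        gcongr ENNReal.ofReal q * ?_
        refine setLIntegral_mono' measurableSet_Ioi fun l hl => ?_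
        have hl : 0 < l := hl
        calc _ ≤ _ := mul_le_mul_right (hweak l hl) _
          _ = 2 * D * (ENNReal.ofReal (l ^ (q - 1 - 1)) *
              ∫⁻ y, {y | ENNReal.ofReal l < 2 * g y}.indicator g y ∂μ) := by
            rw [Real.rpow_sub_one hl.ne' (q - 1), ENNReal.ofReal_div_of_pos hl, div_eq_mul_inv]
            ring
          _ = _ := by
            rw [← lintegral_const_mul' _ _ ENNReal.ofReal_ne_top]
            congr 1
            refine lintegral_congr fun y => ?_
            by_cases hy : ENNReal.ofReal l < 2 * g y <;> simp [indicator, hy]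
    _ ≤ ENNReal.ofReal q * (2 * D * ∫⁻ l in Ioi (0 : ℝ), ∫⁻ y,
        {l : ℝ | ENNReal.ofReal l < 2 * g y}.indicator
        (fun l => ENNReal.ofReal (l ^ (q - 1 - 1))) l * g y ∂μ) := by
        rw [lintegral_const_mul]
        exact Measurable.lintegral_prod_right' (ν := μ)
          (f := fun z : ℝ × Euc d => {l : ℝ | ENNReal.ofReal l < 2 * g z.2}.indicator
          (fun l => ENNReal.ofReal (l ^ (q - 1 - 1))) z.1 * g z.2)
          ((((hpm (q - 1 - 1)).comp measurable_fst).indicator hmeas2).mul (hg.comp measurable_snd))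
    _ = ENNReal.ofReal q * (2 * D * ∫⁻ y, (∫⁻ l in Ioi (0 : ℝ),
        {l : ℝ | ENNReal.ofReal l < 2 * g y}.indicator
        (fun l => ENNReal.ofReal (l ^ (q - 1 - 1))) l * g y) ∂μ) := by
        rw [lintegral_lintegral_swap]
        exact ((((hpm (q - 1 - 1)).comp measurable_fst).indicator hmeas2).mul
          (hg.comp measurable_snd)).aemeasurable
    _ = ENNReal.ofReal q * (2 * D * ∫⁻ y,
        2 ^ (q - 1) / ENNReal.ofReal (q - 1) * g y ^ q ∂μ) := by
        congr 2
        refine lintegral_congr fun y => ?_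
        rw [lintegral_mul_const _ (Measurable.indicator (hpm _)
          (measurableSet_lt ENNReal.measurable_ofReal measurable_const)),
          lintegral_Ioi_rpow_indicator (by linarith), ENNReal.mul_rpow_of_nonneg _ _ (by linarith)]
        have e : g y ^ q = g y ^ (q - 1) * g y := by
          conv_lhs => rw [show q = (q - 1) + 1 by ring]
          rw [ENNReal.rpow_add_of_nonneg _ _ (by linarith) zero_le_one, ENNReal.rpow_one]
        rw [e, div_eq_mul_inv, div_eq_mul_inv]
        ring
    _ = _ := by
        rw [lintegral_const_mul _ (hg.pow_const q)]
        ring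

end WeakType

section MaxFn

variable {d : ℕ}

theorem volume_ball_mul (x x' : Euc d) {c : ℝ} (hc : 0 < c) (r : ℝ) :
    volume (ball x (c * r)) = ENNReal.ofReal (c ^ d) * volume (ball x' r) := by
  rw [Measure.addHaar_ball_mul_of_pos _ _ hc, Measure.addHaar_ball_center volume x' r,
    finrank_euclideanSpace_fin]

theorem volume_ball_ne_zero (x : Euc d) {r : ℝ} (hr : 0 < r) : volume (ball x r) ≠ 0 :=
  (measure_ball_pos volume x hr).ne'

theorem volume_ball_ne_top (x : Euc d) (r : ℝ) : volume (ball x r) ≠ ∞ :=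
  measure_ball_lt_top.ne

theorem setLIntegral_ball_le_maxFn (g : Euc d → ℝ≥0∞) (x : Euc d) {r : ℝ} (hr : 0 < r) :
    ∫⁻ y in ball x r, g y ≤ volume (ball x r) * maxFn g x := by
  have : (volume (ball x r))⁻¹ * ∫⁻ y in ball x r, g y ≤ maxFn g x :=
    le_iSup₂ (f := fun (r : ℝ) (_ : 0 < r) => (volume (ball x r))⁻¹ * ∫⁻ y in ball x r, g y) r hr
  rwa [mul_comm, ← div_eq_mul_inv,
    ENNReal.div_le_iff' (volume_ball_ne_zero x hr) (volume_ball_ne_top x r)] at this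

theorem maxFn_le_iff {g : Euc d → ℝ≥0∞} {x : Euc d} {t : ℝ≥0∞} :
    maxFn g x ≤ t ↔ ∀ r, 0 < r → ∫⁻ y in ball x r, g y ≤ volume (ball x r) * t := by
  refine ⟨fun h r hr => (setLIntegral_ball_le_maxFn g x hr).trans (by gcongr), fun h => ?_⟩
  refine iSup₂_le fun r hr => ?_
  rw [mul_comm, ← div_eq_mul_inv,
    ENNReal.div_le_iff' (volume_ball_ne_zero x hr) (volume_ball_ne_top x r)]
  exact h r hr

theorem exists_of_lt_maxFn {g : Euc d → ℝ≥0∞} {x : Euc d} {t : ℝ≥0∞} (h : t < maxFn g x) :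
    ∃ r, 0 < r ∧ t * volume (ball x r) ≤ ∫⁻ y in ball x r, g y := by
  by_contra! hcon
  exact absurd (maxFn_le_iff.2 fun r hr => (mul_comm t _ ▸ hcon r hr).le) (not_le.2 h)

theorem maxFn_congr_ae {f g : Euc d → ℝ≥0∞} (h : f =ᵐ[volume] g) : maxFn f = maxFn g := by
  funext x
  simp only [maxFn, lintegral_congr_ae (ae_restrict_of_ae h)]

theorem maxFn_const_mul_le {c : ℝ≥0∞} (hc : c ≠ ∞) (g : Euc d → ℝ≥0∞) (x : Euc d) :
    maxFn (fun y => c * g y) x ≤ c * maxFn g x :=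
  maxFn_le_iff.2 fun r hr => by
    rw [lintegral_const_mul' _ _ hc, mul_left_comm]
    gcongr
    exact setLIntegral_ball_le_maxFn g x hr

theorem maxFn_tsum_le {g : ℕ → Euc d → ℝ≥0∞} (hg : ∀ k, Measurable (g k)) (x : Euc d) :
    maxFn (fun y => ∑' k, g k y) x ≤ ∑' k, maxFn (g k) x :=
  maxFn_le_iff.2 fun r hr => by
    rw [lintegral_tsum fun k => (hg k).aemeasurable, ← ENNReal.tsum_mul_left]
    exact ENNReal.tsum_le_tsum fun k => setLIntegral_ball_le_maxFn (g k) x hr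

theorem lowerSemicontinuous_measure_ball (ν : Measure (Euc d)) (r : ℝ) :
    LowerSemicontinuous fun x => ν (ball x r) := by
  intro x t ht
  have hU : ball x r = ⋃ n : ℕ, ball x (r - 1 / ((n : ℝ) + 1)) := by
    ext y
    simp only [mem_iUnion, mem_ball]
    constructor
    · intro hy
      obtain ⟨n, hn⟩ := exists_nat_one_div_lt (sub_pos.2 hy)
      exact ⟨n, by linarith⟩
    · rintro ⟨n, hn⟩
      have : (0 : ℝ) < 1 / ((n : ℝ) + 1) := by positivity
      linarith
  have hmono : Monotone fun n : ℕ => ball x (r - 1 / ((n : ℝ) + 1)) := fun m n hmn =>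
    ball_subset_ball (sub_le_sub_left (Nat.one_div_le_one_div hmn) r)
  change t < ν (ball x r) at ht
  rw [hU, hmono.measure_iUnion, lt_iSup_iff] at ht
  obtain ⟨n, hn⟩ := ht
  have hpos : (0 : ℝ) < 1 / ((n : ℝ) + 1) := by positivity
  filter_upwards [ball_mem_nhds x hpos] with y hy
  refine hn.trans_le (measure_mono (ball_subset_ball' ?_))
  rw [dist_comm]
  linarith [mem_ball.1 hy]

theorem measurable_maxFn (g : Euc d → ℝ≥0∞) : Measurable (maxFn g) := by
  refine LowerSemicontinuous.measurable ?_
  refine lowerSemicontinuous_iSup fun r => lowerSemicontinuous_iSup fun hr => ?_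
  have h : (fun x : Euc d => (volume (ball x r))⁻¹ * ∫⁻ y in ball x r, g y) =
      fun x => (volume (ball (0 : Euc d) r))⁻¹ * (volume.withDensity g) (ball x r) := by
    funext x
    rw [withDensity_apply _ measurableSet_ball, Measure.addHaar_ball_center]
  rw [h]
  intro x t ht
  have hc0 : (volume (ball (0 : Euc d) r))⁻¹ ≠ 0 := ENNReal.inv_ne_zero.2 (volume_ball_ne_top _ _)
  have hct : (volume (ball (0 : Euc d) r))⁻¹ ≠ ∞ := ENNReal.inv_ne_top.2 (volume_ball_ne_zero _ hr)
  change t < (volume (ball (0 : Euc d) r))⁻¹ * volume.withDensity g (ball x r) at ht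
  rw [mul_comm, ← ENNReal.div_lt_iff (Or.inl hc0) (Or.inl hct)] at ht
  filter_upwards [lowerSemicontinuous_measure_ball (volume.withDensity g) r x _ ht] with y hy
  change t < (volume (ball (0 : Euc d) r))⁻¹ * volume.withDensity g (ball y r)
  rwa [mul_comm, ← ENNReal.div_lt_iff (Or.inl hc0) (Or.inl hct)]

end MaxFn

section Weights

variable {d : ℕ} {K : ℝ≥0∞} {W : Euc d → ℝ≥0∞}

/-- A Muckenhoupt `A₁` condition holding at every point. -/
def IsA1 (K : ℝ≥0∞) (W : Euc d → ℝ≥0∞) : Prop :=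
  ∀ x r, 0 < r → ∀ y ∈ ball x r, ∫⁻ z in ball x r, W z ≤ K * volume (ball x r) * W y

theorem isA1_of_maxFn_le (h : ∀ y, maxFn W y ≤ K * W y) :
    IsA1 (ENNReal.ofReal (2 ^ d) * K) W := fun x r hr y hy => by
  have hsub : ball x r ⊆ ball y (2 * r) := ball_subset_ball' (by
    linarith [mem_ball'.1 hy])
  calc ∫⁻ z in ball x r, W z ≤ ∫⁻ z in ball y (2 * r), W z := lintegral_mono_set hsub
    _ ≤ volume (ball y (2 * r)) * maxFn W y := setLIntegral_ball_le_maxFn W y (by linarith)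
    _ ≤ ENNReal.ofReal (2 ^ d) * volume (ball x r) * (K * W y) := by
      rw [volume_ball_mul y x two_pos r]
      gcongr
      exact h y
    _ = _ := by ring

theorem IsA1.rpow (hA : IsA1 K W) (hW : Measurable W) {δ : ℝ} (h0 : 0 ≤ δ) (h1 : δ ≤ 1) :
    IsA1 (K ^ δ) fun x => W x ^ δ := fun x r hr y hy => by
  have hv0 := volume_ball_ne_zero x hr
  have hvt := volume_ball_ne_top x r
  calc ∫⁻ z in ball x r, W z ^ δ = ∫⁻ z in ball x r, W z ^ δ * 1 ^ (1 - δ) := by simp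
    _ ≤ (∫⁻ z in ball x r, W z) ^ δ * (∫⁻ z in ball x r, 1) ^ (1 - δ) :=
      ENNReal.lintegral_mul_norm_pow_le hW.aemeasurable aemeasurable_const h0 (by linarith)
        (by ring)
    _ ≤ (K * volume (ball x r) * W y) ^ δ * volume (ball x r) ^ (1 - δ) := by
      rw [setLIntegral_one]
      gcongr
      exact hA x r hr y hy
    _ = K ^ δ * (volume (ball x r) ^ δ * volume (ball x r) ^ (1 - δ)) * W y ^ δ := by
      rw [ENNReal.mul_rpow_of_nonneg _ _ h0, ENNReal.mul_rpow_of_nonneg _ _ h0]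
      ring
    _ = _ := by rw [← ENNReal.rpow_add _ _ hv0 hvt, add_sub_cancel, ENNReal.rpow_one]

theorem IsA1.setLIntegral_ball_ne_top (hA : IsA1 K W) (hK : K ≠ ∞) (hlt : ∀ᵐ x, W x ≠ ∞)
    (x : Euc d) (r : ℝ) : ∫⁻ z in ball x r, W z ≠ ∞ := by
  rcases le_or_gt r 0 with hr | hr
  · simp [ball_eq_empty.2 hr]
  obtain ⟨y, hy, hyt⟩ : ∃ y ∈ ball x r, W y ≠ ∞ := by
    by_contra! hcon
    refine volume_ball_ne_zero x hr (measure_mono_null (fun y hy => ?_) hlt)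
    simpa using hcon y hy
  exact ne_top_of_le_ne_top
    (ENNReal.mul_ne_top (ENNReal.mul_ne_top hK (volume_ball_ne_top x r)) hyt) (hA x r hr y hy)

theorem IsA1.doubling (hA : IsA1 K W) (hW : Measurable W) (x : Euc d) {r : ℝ} (hr : 0 < r) :
    volume.withDensity W (closedBall x (5 * r)) ≤
      K * ENNReal.ofReal (6 ^ d) * volume.withDensity W (ball x r) := by
  have hsub : closedBall x (5 * r) ⊆ ball x (6 * r) := closedBall_subset_ball (by linarith)
  refine (measure_mono hsub).trans ?_
  rw [withDensity_apply _ measurableSet_ball, withDensity_apply _ measurableSet_ball]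
  have hv0 := volume_ball_ne_zero x hr
  have hvt := volume_ball_ne_top x r
  rw [← ENNReal.mul_le_mul_iff_right hv0 hvt]
  calc volume (ball x r) * ∫⁻ z in ball x (6 * r), W z
      = ∫⁻ _ in ball x r, ∫⁻ z in ball x (6 * r), W z := by rw [setLIntegral_const, mul_comm]
    _ ≤ ∫⁻ y in ball x r, K * volume (ball x (6 * r)) * W y :=
      setLIntegral_mono' measurableSet_ball fun y hy =>
        hA x (6 * r) (by linarith) y (ball_subset_ball (by linarith) hy)
    _ = K * volume (ball x (6 * r)) * ∫⁻ y in ball x r, W y := lintegral_const_mul _ hW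
    _ = _ := by
      rw [volume_ball_mul x x (by norm_num : (0 : ℝ) < 6) r]
      ring

/-- The constant in the weighted maximal inequalities for `A₁` weights. -/
def a1Const (d : ℕ) (q : ℝ) (K : ℝ≥0∞) : ℝ≥0∞ :=
  ENNReal.ofReal q * (2 * (K * ENNReal.ofReal (6 ^ d)) * (2 ^ (q - 1) / ENNReal.ofReal (q - 1))) *
    K ^ q

theorem a1Const_ne_top (d : ℕ) {q : ℝ} (hq : 1 < q) (hK : K ≠ ∞) : a1Const d q K ≠ ∞ := by
  have h1 : (2 : ℝ≥0∞) ^ (q - 1) / ENNReal.ofReal (q - 1) ≠ ∞ :=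
    ENNReal.div_ne_top (ENNReal.rpow_ne_top_of_nonneg (by linarith) (by simp)) (by simpa using hq)
  have h2 : K ^ q ≠ ∞ := ENNReal.rpow_ne_top_of_nonneg (by linarith) hK
  unfold a1Const
  finiteness

theorem IsA1.lintegral_rpow_le (hA : IsA1 K W) (hW : Measurable W) (hK : K ≠ ∞)
    (hlt : ∀ᵐ x, W x ≠ ∞) {q : ℝ} (hq : 1 < q) {φ g : Euc d → ℝ≥0∞} (hφ : Measurable φ)
    (hg : Measurable g)
    (h : ∀ x t, t < φ x → ∃ r, 0 < r ∧
      t * ∫⁻ z in ball x r, W z ≤ K * ∫⁻ y in ball x r, g y * W y) :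
    ∫⁻ x, φ x ^ q * W x ≤ a1Const d q K * ∫⁻ x, g x ^ q * W x := by
  have key := lintegral_rpow_le_of_ball_average (μ := volume.withDensity W)
    (D := K * ENNReal.ofReal (6 ^ d)) (φ := φ) (g := fun x => K * g x) hq
    (fun x r hr => hA.doubling hW x hr)
    (fun x r => by
      rw [withDensity_apply _ measurableSet_ball]
      exact hA.setLIntegral_ball_ne_top hK hlt x r) hφ (hg.const_mul K) ?_
  · rw [lintegral_withDensity_eq_lintegral_mul _ hW (hφ.pow_const q),
      lintegral_withDensity_eq_lintegral_mul _ hW ((hg.const_mul K).pow_const q)] at key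
    simp only [Pi.mul_apply, mul_comm (W _)] at key
    refine key.trans_eq ?_
    have hq0 : 0 ≤ q := by linarith
    simp only [ENNReal.mul_rpow_of_nonneg _ _ hq0, mul_assoc]
    rw [lintegral_const_mul' _ _ (ENNReal.rpow_ne_top_of_nonneg hq0 hK), a1Const]
    ring
  · intro x t ht
    obtain ⟨r, hr, hle⟩ := h x t ht
    refine ⟨r, hr, ?_⟩
    rw [withDensity_apply _ measurableSet_ball,
      setLIntegral_withDensity_eq_setLIntegral_mul _ hW (hg.const_mul K) measurableSet_ball]
    refine hle.trans_eq ?_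
    rw [← lintegral_const_mul' _ _ hK]
    refine lintegral_congr fun y => ?_
    simp only [Pi.mul_apply]
    ring

/-- The maximal operator is bounded on `L^q(W)` for `W ∈ A₁`. -/
theorem IsA1.lintegral_maxFn_rpow_mul_le (hA : IsA1 K W) (hW : Measurable W) (hK : K ≠ ∞)
    (hlt : ∀ᵐ x, W x ≠ ∞) {q : ℝ} (hq : 1 < q) {g : Euc d → ℝ≥0∞} (hg : Measurable g) :
    ∫⁻ x, maxFn g x ^ q * W x ≤ a1Const d q K * ∫⁻ x, g x ^ q * W x := by
  refine hA.lintegral_rpow_le hW hK hlt hq (measurable_maxFn g) hg fun x t ht => ?_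
  obtain ⟨r, hr, hle⟩ := exists_of_lt_maxFn ht
  refine ⟨r, hr, ?_⟩
  have hv0 := volume_ball_ne_zero x hr
  have hvt := volume_ball_ne_top x r
  rw [← ENNReal.mul_le_mul_iff_right hv0 hvt]
  calc volume (ball x r) * (t * ∫⁻ z in ball x r, W z)
      = (t * volume (ball x r)) * ∫⁻ z in ball x r, W z := by ring
    _ ≤ (∫⁻ y in ball x r, g y) * ∫⁻ z in ball x r, W z := by gcongr
    _ = ∫⁻ y in ball x r, g y * ∫⁻ z in ball x r, W z := (lintegral_mul_const _ hg).symm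
    _ ≤ ∫⁻ y in ball x r, (K * volume (ball x r)) * (g y * W y) :=
      setLIntegral_mono' measurableSet_ball fun y hy => by
        rw [mul_left_comm]
        gcongr
        exact hA x r hr y hy
    _ = _ := by
      rw [lintegral_const_mul' _ _ (ENNReal.mul_ne_top hK hvt)]
      ring

/-- The maximal operator is bounded on `L^q(W^{1-q})` for `W ∈ A₁`. -/
theorem IsA1.lintegral_maxFn_div_rpow_mul_le (hA : IsA1 K W) (hW : Measurable W) (hK : K ≠ ∞)
    (h0 : ∀ x, W x ≠ 0) (hlt : ∀ᵐ x, W x ≠ ∞) {q : ℝ} (hq : 1 < q) {g : Euc d → ℝ≥0∞}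
    (hg : Measurable g) :
    ∫⁻ x, (maxFn g x / W x) ^ q * W x ≤ a1Const d q K * ∫⁻ x, (g x / W x) ^ q * W x := by
  refine hA.lintegral_rpow_le hW hK hlt hq ((measurable_maxFn g).div hW) (hg.div hW)
    fun x t ht => ?_
  have hx : t * W x < maxFn g x := by
    by_contra! hcon
    exact absurd (ENNReal.div_le_of_le_mul hcon) (not_le.2 ht)
  obtain ⟨r, hr, hle⟩ := exists_of_lt_maxFn hx
  refine ⟨r, hr, ?_⟩
  calc t * ∫⁻ z in ball x r, W z ≤ t * (K * volume (ball x r) * W x) := by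
        gcongr
        exact hA x r hr x (mem_ball_self hr)
    _ = K * (t * W x * volume (ball x r)) := by ring
    _ ≤ K * ∫⁻ y in ball x r, g y := by gcongr
    _ = _ := by
      congr 1
      refine lintegral_congr_ae (ae_restrict_of_ae ?_)
      filter_upwards [hlt] with y hy
      rw [ENNReal.div_mul_cancel (h0 y) hy]

end Weights

section VectorValued

variable {d : ℕ}

theorem exists_lintegral_maxFn_rpow_le (d : ℕ) {p : ℝ} (hp : 1 < p) :
    ∃ C : ℝ≥0∞, C ≠ ∞ ∧ ∀ g : Euc d → ℝ≥0∞, Measurable g →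
      ∫⁻ x, maxFn g x ^ p ≤ C * ∫⁻ x, g x ^ p := by
  have hA : IsA1 (d := d) 1 fun _ => 1 := fun x r hr y hy => by simp
  refine ⟨a1Const d p 1, a1Const_ne_top d hp one_ne_top, fun g hg => ?_⟩
  simpa using hA.lintegral_maxFn_rpow_mul_le measurable_const one_ne_top (by simp) hp hg

theorem ae_eq_zero_of_maxFn_eq_zero {g : Euc d → ℝ≥0∞} (hg : Measurable g) {x : Euc d}
    (h : maxFn g x = 0) : g =ᵐ[volume] 0 := by
  rw [← lintegral_eq_zero_iff hg, ← setLIntegral_univ, ← iUnion_ball_nat x]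
  refine le_antisymm ((lintegral_iUnion_le _ _).trans ?_) zero_le
  refine (ENNReal.tsum_eq_zero.2 fun n => ?_).le
  rcases Nat.eq_zero_or_pos n with rfl | hn
  · simp
  · simpa [h] using setLIntegral_ball_le_maxFn g x (Nat.cast_pos.2 hn)

/-- Rubio de Francia's algorithm: every function has an `A₁` majorant of comparable `L^p` norm. -/
theorem exists_isA1_majorant (d : ℕ) {p : ℝ} (hp : 1 < p) :
    ∃ K C : ℝ≥0∞, K ≠ ∞ ∧ C ≠ ∞ ∧ ∀ h : Euc d → ℝ≥0∞, Measurable h →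
      ∃ W : Euc d → ℝ≥0∞, Measurable W ∧ IsA1 K W ∧ (∀ x, h x ≤ W x) ∧
        ∫⁻ x, W x ^ p ≤ C * ∫⁻ x, h x ^ p ∧ (¬ h =ᵐ[volume] 0 → ∀ x, W x ≠ 0) := by
  obtain ⟨A, hA, hM⟩ := exists_lintegral_maxFn_rpow_le d hp
  have hp0 : 0 < p := by linarith
  set t : ℝ≥0∞ := ((2 * (A + 1))⁻¹) ^ (1 / p) with ht
  have htp : t ^ p = (2 * (A + 1))⁻¹ := by
    rw [ht, ← ENNReal.rpow_mul, one_div_mul_cancel hp0.ne', ENNReal.rpow_one]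
  have hA1 : 2 * (A + 1) ≠ ∞ := by finiteness
  have htt : t ≠ ∞ := ENNReal.rpow_ne_top_of_nonneg (by positivity) (by simp)
  have ht0 : t ≠ 0 := by
    simp only [ht, ne_eq, ENNReal.rpow_eq_zero_iff, ENNReal.inv_eq_zero, ENNReal.inv_eq_top, hA1,
      false_and, false_or]
    simp
  have htA : t ^ p * A ≤ 2⁻¹ := by
    rw [htp, ENNReal.mul_inv (by simp) (by simp), mul_assoc]
    refine mul_le_of_le_one_right' ?_
    rw [mul_comm, ← div_eq_mul_inv]
    exact ENNReal.div_le_of_le_mul (by rw [one_mul]; exact le_self_add)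
  set c : ℝ≥0∞ := 2⁻¹ * t with hc
  have hc0 : c ≠ 0 := mul_ne_zero (by simp) ht0
  have hct : c ≠ ∞ := ENNReal.mul_ne_top (by simp) htt
  refine ⟨ENNReal.ofReal (2 ^ d) * c⁻¹, 2 ^ p * 2, by finiteness,
    ENNReal.mul_ne_top (ENNReal.rpow_ne_top_of_nonneg hp0.le (by simp)) (by simp),
    fun h hh => ?_⟩
  have hmeas : ∀ k, Measurable (maxFn^[k] h) := fun k => by
    cases k with
    | zero => exact hh
    | succ k => rw [Function.iterate_succ_apply']; exact measurable_maxFn _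
  refine ⟨fun x => ∑' k : ℕ, c ^ k * maxFn^[k] h x, ?_, isA1_of_maxFn_le fun x => ?_,
    fun x => ?_, ?_, fun hne x => ?_⟩
  · exact Measurable.tsum fun k => (hmeas k).const_mul _
  · calc maxFn (fun x => ∑' k : ℕ, c ^ k * maxFn^[k] h x) x
        ≤ ∑' k : ℕ, maxFn (fun x => c ^ k * maxFn^[k] h x) x :=
          maxFn_tsum_le (fun k => (hmeas k).const_mul _) x
      _ ≤ ∑' k : ℕ, c⁻¹ * (c ^ (k + 1) * maxFn^[k + 1] h x) := by
          refine ENNReal.tsum_le_tsum fun k => ?_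
          rw [Function.iterate_succ_apply', pow_succ', mul_assoc, ← mul_assoc c⁻¹,
            ENNReal.inv_mul_cancel hc0 hct, one_mul]
          exact maxFn_const_mul_le (by finiteness) _ x
      _ ≤ c⁻¹ * ∑' k : ℕ, c ^ k * maxFn^[k] h x := by
          rw [ENNReal.tsum_mul_left]
          gcongr c⁻¹ * ?_
          exact ENNReal.tsum_comp_le_tsum_of_injective (add_left_injective 1)
            fun k => c ^ k * maxFn^[k] h x
  · simpa using ENNReal.le_tsum (f := fun k : ℕ => c ^ k * maxFn^[k] h x) 0
  · have hterm : ∀ k : ℕ, ∫⁻ x, (t ^ k * maxFn^[k] h x) ^ p ≤ 2⁻¹ ^ k * ∫⁻ x, h x ^ p := by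
      intro k
      induction k with
      | zero => simp
      | succ k ih =>
        calc ∫⁻ x, (t ^ (k + 1) * maxFn^[k + 1] h x) ^ p
            = (t ^ (k + 1)) ^ p * ∫⁻ x, maxFn (maxFn^[k] h) x ^ p := by
              simp only [ENNReal.mul_rpow_of_nonneg _ _ hp0.le, Function.iterate_succ_apply']
              exact lintegral_const_mul' _ _ (ENNReal.rpow_ne_top_of_nonneg hp0.le (by finiteness))
          _ ≤ (t ^ (k + 1)) ^ p * (A * ∫⁻ x, maxFn^[k] h x ^ p) := by
              gcongr
              exact hM _ (hmeas k)
          _ = t ^ p * A * ∫⁻ x, (t ^ k * maxFn^[k] h x) ^ p := by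
              simp only [ENNReal.mul_rpow_of_nonneg _ _ hp0.le]
              rw [lintegral_const_mul' _ _
                (ENNReal.rpow_ne_top_of_nonneg hp0.le (by finiteness)), pow_succ,
                ENNReal.mul_rpow_of_nonneg _ _ hp0.le]
              ring
          _ ≤ 2⁻¹ * (2⁻¹ ^ k * ∫⁻ x, h x ^ p) := by gcongr
          _ = _ := by ring
    have hgeom : ∑' k : ℕ, (2⁻¹ : ℝ≥0∞) ^ k = 2 := by
      rw [ENNReal.tsum_geometric, ENNReal.one_sub_inv_two, inv_inv]
    calc ∫⁻ x, (∑' k : ℕ, c ^ k * maxFn^[k] h x) ^ p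
        ≤ ∫⁻ x, 2 ^ p * ∑' k : ℕ, (t ^ k * maxFn^[k] h x) ^ p := by
          refine lintegral_mono fun x => ?_
          set S := ∑' k : ℕ, (t ^ k * maxFn^[k] h x) ^ p
          have hS : ∀ k, t ^ k * maxFn^[k] h x ≤ S ^ (1 / p) := fun k => by
            rw [one_div, ENNReal.le_rpow_inv_iff hp0]
            exact ENNReal.le_tsum (f := fun k : ℕ => (t ^ k * maxFn^[k] h x) ^ p) k
          calc (∑' k : ℕ, c ^ k * maxFn^[k] h x) ^ p
              ≤ (∑' k : ℕ, 2⁻¹ ^ k * S ^ (1 / p)) ^ p := by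
                refine ENNReal.rpow_le_rpow (ENNReal.tsum_le_tsum fun k => ?_) hp0.le
                rw [hc, mul_pow, mul_assoc]
                gcongr
                exact hS k
            _ = _ := by
                rw [ENNReal.tsum_mul_right, hgeom, ENNReal.mul_rpow_of_nonneg _ _ hp0.le,
                  ← ENNReal.rpow_mul, one_div_mul_cancel hp0.ne', ENNReal.rpow_one]
      _ = 2 ^ p * ∑' k : ℕ, ∫⁻ x, (t ^ k * maxFn^[k] h x) ^ p := by
          rw [lintegral_const_mul' _ _ (ENNReal.rpow_ne_top_of_nonneg hp0.le (by simp)),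
            lintegral_tsum fun k => (((hmeas k).const_mul _).pow_const p).aemeasurable]
      _ ≤ 2 ^ p * ∑' k : ℕ, 2⁻¹ ^ k * ∫⁻ x, h x ^ p := by
          gcongr with k
          exact hterm k
      _ = _ := by
          rw [ENNReal.tsum_mul_right, hgeom]
          ring
  · intro hx
    have := ENNReal.tsum_eq_zero.1 hx 1
    simp only [pow_one, Function.iterate_one, mul_eq_zero, hc0, false_or] at this
    exact hne (ae_eq_zero_of_maxFn_eq_zero hh this)

theorem lintegral_tsum_mul {f : ℕ → Euc d → ℝ≥0∞} {w : Euc d → ℝ≥0∞}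
    (hf : ∀ j, Measurable (f j)) (hw : Measurable w) :
    ∫⁻ x, (∑' j, f j x) * w x = ∑' j, ∫⁻ x, f j x * w x := by
  simp_rw [← ENNReal.tsum_mul_right]
  exact lintegral_tsum fun j => ((hf j).mul hw).aemeasurable

theorem ae_ne_top_of_lintegral_rpow_ne_top {p : ℝ} (hp : 0 < p) {W : Euc d → ℝ≥0∞}
    (hW : Measurable W) (h : ∫⁻ x, W x ^ p ≠ ∞) : ∀ᵐ x, W x ≠ ∞ := by
  filter_upwards [ae_lt_top (hW.pow_const p) h] with x hx hx'
  simp [hx', hp] at hx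

theorem exists_feffermanStein_of_le (d : ℕ) {p q : ℝ} (hp : 1 < p) (hpq : p ≤ q) :
    ∃ C : ℝ≥0∞, C ≠ ∞ ∧ ∀ g : ℕ → Euc d → ℝ≥0∞, (∀ j, Measurable (g j)) →
      ∫⁻ x, (∑' j, maxFn (g j) x ^ q) ^ (p / q) ≤ C * ∫⁻ x, (∑' j, g j x ^ q) ^ (p / q) := by
  obtain ⟨K, C, hK, hC, hR⟩ := exists_isA1_majorant d hp
  have hq : 1 < q := by linarith
  have hp0 : 0 < p := by linarith
  have hq0 : 0 < q := by linarith
  set δ := (q - p) / (q - 1) with hδ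
  have hδ0 : 0 ≤ δ := div_nonneg (by linarith) (by linarith)
  have hδ1 : δ ≤ 1 := (div_le_one (by linarith)).2 (by linarith)
  have hδq : δ * (1 - q) = p - q := by
    rw [hδ, div_mul_eq_mul_div, div_eq_iff (by linarith)]
    ring
  have hKδ : K ^ δ ≠ ∞ := ENNReal.rpow_ne_top_of_nonneg hδ0 hK
  set B := a1Const d q (K ^ δ) with hB
  have hBt : B ≠ ∞ := a1Const_ne_top d hq hKδ
  have hpq0 : 0 < p / q := by positivity
  have hpq1 : 0 ≤ 1 - p / q := by
    rw [sub_nonneg, div_le_one hq0]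
    exact hpq
  refine ⟨B ^ (p / q) * C ^ (1 - p / q) + 1, ?_, fun g hg => ?_⟩
  · have h1 := ENNReal.rpow_ne_top_of_nonneg hpq0.le hBt
    have h2 := ENNReal.rpow_ne_top_of_nonneg hpq1 hC
    finiteness
  set F : Euc d → ℝ≥0∞ := fun x => (∑' j, g j x ^ q) ^ (1 / q) with hF
  have hFm : Measurable F := (Measurable.tsum fun j => (hg j).pow_const q).pow_const _
  have hFq : ∀ x, F x ^ q = ∑' j, g j x ^ q := fun x => by
    rw [hF, ← ENNReal.rpow_mul, one_div_mul_cancel hq0.ne', ENNReal.rpow_one]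
  have hFp : ∀ x, (∑' j, g j x ^ q) ^ (p / q) = F x ^ p := fun x => by
    rw [hF, ← ENNReal.rpow_mul]
    congr 1
    ring
  simp only [hFp]
  by_cases hFtop : ∫⁻ x, F x ^ p = ∞
  · rw [hFtop, ENNReal.mul_top (by simp)]
    exact le_top
  by_cases hF0 : F =ᵐ[volume] 0
  · have hg0 : ∀ j, maxFn (g j) = 0 := fun j => by
      have : g j =ᵐ[volume] 0 := by
        filter_upwards [hF0] with x hx
        have h1 : ∑' j, g j x ^ q = 0 := by rw [← hFq, hx]; simp [hq0]
        simpa [hq0, hq0.le, not_lt.2 hq0.le] using ENNReal.tsum_eq_zero.1 h1 j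
      rw [maxFn_congr_ae this]
      funext x
      simp [maxFn]
    simp [hg0, hq0, hpq0]
  obtain ⟨W, hW, hA, hFW, hWp, hW0⟩ := hR F hFm
  replace hW0 := hW0 hF0
  have hWt : ∀ᵐ x, W x ≠ ∞ := ae_ne_top_of_lintegral_rpow_ne_top hp0 hW
    (ne_top_of_le_ne_top (ENNReal.mul_ne_top hC hFtop) hWp)
  set V : Euc d → ℝ≥0∞ := fun x => W x ^ δ with hV
  have hVm : Measurable V := hW.pow_const δ
  have hAV : IsA1 (K ^ δ) V := hA.rpow hW hδ0 hδ1
  have hV0 : ∀ x, V x ≠ 0 := fun x => by simp [hV, hW0 x, hδ0]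
  have hVt : ∀ᵐ x, V x ≠ ∞ := by
    filter_upwards [hWt] with x hx using ENNReal.rpow_ne_top_of_nonneg hδ0 hx
  have hVW : ∀ᵐ x, ∀ a : ℝ≥0∞, (a / V x) ^ q * V x = a ^ q * W x ^ (p - q) := by
    filter_upwards [hWt, hVt] with x hx hvx a
    rw [ENNReal.div_rpow_of_nonneg _ _ hq0.le, div_eq_mul_inv, mul_assoc, ← ENNReal.rpow_neg]
    nth_rewrite 2 [← ENNReal.rpow_one (V x)]
    rw [← ENNReal.rpow_add _ _ (hV0 x) hvx, hV, ← ENNReal.rpow_mul, ← hδq]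
    congr 3
    ring
  have hG : ∫⁻ x, (∑' j, maxFn (g j) x ^ q) * W x ^ (p - q) ≤ B * ∫⁻ x, F x ^ p := by
    have hWm := hW.pow_const (p - q)
    calc ∫⁻ x, (∑' j, maxFn (g j) x ^ q) * W x ^ (p - q)
        = ∑' j, ∫⁻ x, maxFn (g j) x ^ q * W x ^ (p - q) := by
          exact lintegral_tsum_mul (fun j => (measurable_maxFn (g j)).pow_const q) hWm
      _ ≤ ∑' j, B * ∫⁻ x, g j x ^ q * W x ^ (p - q) := by
          refine ENNReal.tsum_le_tsum fun j => ?_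
          have := hAV.lintegral_maxFn_div_rpow_mul_le hVm hKδ hV0 hVt hq (hg j)
          rwa [lintegral_congr_ae (hVW.mono fun x hx => hx (maxFn (g j) x)),
            lintegral_congr_ae (hVW.mono fun x hx => hx (g j x))] at this
      _ = B * ∫⁻ x, F x ^ q * W x ^ (p - q) := by
          rw [ENNReal.tsum_mul_left, ← lintegral_tsum_mul (fun j => (hg j).pow_const q) hWm]
          simp only [hFq]
      _ ≤ B * ∫⁻ x, F x ^ p := by
          gcongr B * ?_
          refine lintegral_mono_ae ?_
          filter_upwards [hWt] with x hx
          have hqp : 0 ≤ q - p := by linarith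
          calc F x ^ q * W x ^ (p - q) = F x ^ p * (F x ^ (q - p) * W x ^ (p - q)) := by
                rw [← mul_assoc, ← ENNReal.rpow_add_of_nonneg _ _ hp0.le hqp, add_sub_cancel]
            _ ≤ F x ^ p * (W x ^ (q - p) * W x ^ (p - q)) := by
                gcongr
                exact hFW x
            _ = F x ^ p := by
                rw [← ENNReal.rpow_add _ _ (hW0 x) hx, sub_add_sub_cancel, sub_self,
                  ENNReal.rpow_zero, mul_one]
  calc ∫⁻ x, (∑' j, maxFn (g j) x ^ q) ^ (p / q)
      = ∫⁻ x, ((∑' j, maxFn (g j) x ^ q) * W x ^ (p - q)) ^ (p / q) * (W x ^ p) ^ (1 - p / q) := by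
        refine lintegral_congr_ae ?_
        filter_upwards [hWt] with x hx
        rw [ENNReal.mul_rpow_of_nonneg _ _ hpq0.le, mul_assoc, ← ENNReal.rpow_mul,
          ← ENNReal.rpow_mul, ← ENNReal.rpow_add _ _ (hW0 x) hx,
          show (p - q) * (p / q) + p * (1 - p / q) = 0 by field_simp; ring, ENNReal.rpow_zero,
          mul_one]
    _ ≤ (∫⁻ x, (∑' j, maxFn (g j) x ^ q) * W x ^ (p - q)) ^ (p / q) *
          (∫⁻ x, W x ^ p) ^ (1 - p / q) :=
        ENNReal.lintegral_mul_norm_pow_le ((Measurable.tsum fun j =>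
          (measurable_maxFn (g j)).pow_const q).mul (hW.pow_const _)).aemeasurable
          (hW.pow_const p).aemeasurable hpq0.le hpq1 (by ring)
    _ ≤ (B * ∫⁻ x, F x ^ p) ^ (p / q) * (C * ∫⁻ x, F x ^ p) ^ (1 - p / q) := by gcongr
    _ = B ^ (p / q) * C ^ (1 - p / q) *
        ((∫⁻ x, F x ^ p) ^ (p / q) * (∫⁻ x, F x ^ p) ^ (1 - p / q)) := by
        rw [ENNReal.mul_rpow_of_nonneg _ _ hpq0.le, ENNReal.mul_rpow_of_nonneg _ _ hpq1]
        ring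
    _ = B ^ (p / q) * C ^ (1 - p / q) * ∫⁻ x, F x ^ p := by
        rw [← ENNReal.rpow_add_of_nonneg _ _ hpq0.le hpq1, add_sub_cancel, ENNReal.rpow_one]
    _ ≤ _ := by
        gcongr
        exact le_self_add

theorem exists_feffermanStein_of_lt (d : ℕ) {p q : ℝ} (hq : 1 < q) (hqp : q < p) :
    ∃ C : ℝ≥0∞, C ≠ ∞ ∧ ∀ g : ℕ → Euc d → ℝ≥0∞, (∀ j, Measurable (g j)) →
      ∫⁻ x, (∑' j, maxFn (g j) x ^ q) ^ (p / q) ≤ C * ∫⁻ x, (∑' j, g j x ^ q) ^ (p / q) := by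
  have hq0 : 0 < q := by linarith
  set s := p / q with hs
  have hs1 : 1 < s := (one_lt_div hq0).2 hqp
  have hs0 : 0 < s := by linarith
  set s' := s.conjExponent with hs'
  have hconj : s.HolderConjugate s' := Real.HolderConjugate.conjExponent hs1
  have hs'1 : 1 < s' := hconj.symm.lt
  have hs'0 : 0 < s' := by linarith
  obtain ⟨K, C, hK, hC, hR⟩ := exists_isA1_majorant d hs'1
  set B := a1Const d q K with hB
  have hBt : B ≠ ∞ := a1Const_ne_top d hq hK
  refine ⟨(B * C ^ (1 / s')) ^ s, ?_, fun g hg => ?_⟩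
  · exact ENNReal.rpow_ne_top_of_nonneg hs0.le
      (ENNReal.mul_ne_top hBt (ENNReal.rpow_ne_top_of_nonneg (by positivity) hC))
  set S : Euc d → ℝ≥0∞ := fun x => ∑' j, g j x ^ q with hS
  set G : Euc d → ℝ≥0∞ := fun x => ∑' j, maxFn (g j) x ^ q with hG
  have hSm : Measurable S := Measurable.tsum fun j => (hg j).pow_const q
  have hGm : Measurable G := Measurable.tsum fun j => (measurable_maxFn (g j)).pow_const q
  let T : ℕ → Euc d → ℝ≥0∞ := fun n => (ball 0 (n : ℝ)).indicator fun x => min (G x) n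
  have hTm : ∀ n, Measurable (T n) := fun n =>
    (hGm.min measurable_const).indicator measurableSet_ball
  have hTG : ∀ n x, T n x ≤ G x := fun n x => indicator_le (fun x _ => min_le_left _ _) x
  have hTmono : Monotone T := fun m n hmn x => by
    refine (indicator_le_indicator_of_subset (ball_subset_ball (Nat.cast_le.2 hmn))
      (fun _ => zero_le) x).trans (indicator_le_indicator ?_)
    exact min_le_min le_rfl (Nat.cast_le.2 hmn)
  have hTlim : ∀ x, G x ^ s ≤ ⨆ n, T n x ^ s := fun x => by
    have h1 : Tendsto (fun n : ℕ => min (G x) (n : ℝ≥0∞)) atTop (𝓝 (G x)) := by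
      simpa using (tendsto_const_nhds (x := G x)).min ENNReal.tendsto_nat_nhds_top
    have h2 : Tendsto (fun n => T n x) atTop (𝓝 (G x)) := by
      refine h1.congr' ?_
      obtain ⟨N, hN⟩ := exists_nat_gt (dist x 0)
      filter_upwards [eventually_ge_atTop N] with n hn
      have hx : x ∈ ball (0 : Euc d) n := hN.trans_le (Nat.cast_le.2 hn)
      simp only [T, indicator_of_mem hx]
    exact le_of_tendsto' ((ENNReal.continuous_rpow_const.tendsto _).comp h2)
      fun n => le_iSup (fun n => T n x ^ s) n
  have hbound : ∀ n, ∫⁻ x, T n x ^ s ≤ (B * C ^ (1 / s')) ^ s * ∫⁻ x, S x ^ s := by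
    intro n
    set I := ∫⁻ x, T n x ^ s with hI
    have hIt : I ≠ ∞ := by
      refine ne_top_of_le_ne_top (b := ∫⁻ x in ball (0 : Euc d) n, (n : ℝ≥0∞) ^ s) ?_ ?_
      · rw [setLIntegral_const]
        exact ENNReal.mul_ne_top (ENNReal.rpow_ne_top_of_nonneg hs0.le (by simp))
          (volume_ball_ne_top _ _)
      · rw [← lintegral_indicator measurableSet_ball]
        refine lintegral_mono fun x => ?_
        by_cases hx : x ∈ ball (0 : Euc d) n
        · simp only [T, indicator_of_mem hx]
          gcongr
          exact min_le_right _ _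
        · simp [T, indicator_of_notMem hx, hs0]
    rcases eq_or_ne I 0 with hI0 | hI0
    · rw [hI0]
      exact zero_le
    have hsplit : ∀ x, T n x ^ s = T n x * T n x ^ (s - 1) := fun x => by
      conv_lhs => rw [show s = 1 + (s - 1) by ring]
      rw [ENNReal.rpow_add_of_nonneg _ _ zero_le_one (by linarith), ENNReal.rpow_one]
    obtain ⟨W, hW, hA, hTW, hWs, -⟩ := hR (fun x => T n x ^ (s - 1)) ((hTm n).pow_const _)
    have hpow : ∀ x, (T n x ^ (s - 1)) ^ s' = T n x ^ s := fun x => by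
      rw [← ENNReal.rpow_mul, hs', Real.conjExponent, mul_div_cancel₀ _ (by linarith)]
    simp only [hpow] at hWs
    have hWt : ∀ᵐ x, W x ≠ ∞ := ae_ne_top_of_lintegral_rpow_ne_top hs'0 hW
      (ne_top_of_le_ne_top (ENNReal.mul_ne_top hC hIt) hWs)
    have hmain : I ≤ B * C ^ (1 / s') * (∫⁻ x, S x ^ s) ^ (1 / s) * I ^ (1 / s') :=
      calc I = ∫⁻ x, T n x * T n x ^ (s - 1) := lintegral_congr hsplit
        _ ≤ ∫⁻ x, G x * W x := by
          gcongr with x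
          exacts [hTG n x, hTW x]
        _ = ∑' j, ∫⁻ x, maxFn (g j) x ^ q * W x := by
          exact lintegral_tsum_mul (fun j => (measurable_maxFn (g j)).pow_const q) hW
        _ ≤ ∑' j, B * ∫⁻ x, g j x ^ q * W x :=
          ENNReal.tsum_le_tsum fun j => hA.lintegral_maxFn_rpow_mul_le hW hK hWt hq (hg j)
        _ = B * ∫⁻ x, (S * W) x := by
          rw [ENNReal.tsum_mul_left, ← lintegral_tsum_mul (fun j => (hg j).pow_const q) hW]
          rfl
        _ ≤ B * ((∫⁻ x, S x ^ s) ^ (1 / s) * (∫⁻ x, W x ^ s') ^ (1 / s')) := by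
          gcongr
          exact ENNReal.lintegral_mul_le_Lp_mul_Lq _ hconj hSm.aemeasurable hW.aemeasurable
        _ ≤ B * ((∫⁻ x, S x ^ s) ^ (1 / s) * (C * I) ^ (1 / s')) := by gcongr
        _ = _ := by
          rw [ENNReal.mul_rpow_of_nonneg _ _ (by positivity)]
          ring
    have hI1 : I = I ^ (1 / s) * I ^ (1 / s') := by
      rw [← ENNReal.rpow_add _ _ hI0 hIt, one_div, one_div, hconj.inv_add_inv_eq_one,
        ENNReal.rpow_one]
    have h0 : I ^ (1 / s') ≠ 0 := by simp [hI0, hIt]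
    have ht : I ^ (1 / s') ≠ ∞ := ENNReal.rpow_ne_top_of_nonneg (by positivity) hIt
    have h1 : I ^ (1 / s) ≤ B * C ^ (1 / s') * (∫⁻ x, S x ^ s) ^ (1 / s) := by
      rw [← ENNReal.mul_le_mul_iff_left h0 ht, ← hI1]
      exact hmain
    calc I = (I ^ (1 / s)) ^ s := by
          rw [← ENNReal.rpow_mul, one_div_mul_cancel hs0.ne', ENNReal.rpow_one]
      _ ≤ (B * C ^ (1 / s') * (∫⁻ x, S x ^ s) ^ (1 / s)) ^ s := by gcongr
      _ = _ := by
          rw [ENNReal.mul_rpow_of_nonneg _ _ hs0.le, ← ENNReal.rpow_mul _ _ s,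
            one_div_mul_cancel hs0.ne', ENNReal.rpow_one]
  calc ∫⁻ x, G x ^ s ≤ ∫⁻ x, ⨆ n, T n x ^ s := lintegral_mono hTlim
    _ = ⨆ n, ∫⁻ x, T n x ^ s := lintegral_iSup (fun n => (hTm n).pow_const s)
        fun m n hmn x => ENNReal.rpow_le_rpow (hTmono hmn x) hs0.le
    _ ≤ _ := iSup_le hbound

/-- The Fefferman–Stein vector-valued maximal inequality. -/
theorem exists_feffermanStein (d : ℕ) {p q : ℝ} (hp : 1 < p) (hq : 1 < q) :
    ∃ C : ℝ≥0∞, C ≠ ∞ ∧ ∀ g : ℕ → Euc d → ℝ≥0∞, (∀ j, Measurable (g j)) →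
      ∫⁻ x, (∑' j, maxFn (g j) x ^ q) ^ (p / q) ≤ C * ∫⁻ x, (∑' j, g j x ^ q) ^ (p / q) :=
  (le_or_gt p q).elim (exists_feffermanStein_of_le d hp) (exists_feffermanStein_of_lt d hq)

end VectorValued

section Morrey

variable {d : ℕ}

/-- The average of `g` over the ball `B(x, r)`. -/
def ballAvg (g : Euc d → ℝ≥0∞) (x : Euc d) (r : ℝ) : ℝ≥0∞ :=
  (volume (ball x r))⁻¹ * ∫⁻ y in ball x r, g y

theorem volume_ball_eq (x : Euc d) {r : ℝ} (hr : 0 < r) :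
    volume (ball x r) = ENNReal.ofReal r ^ (d : ℝ) * volume (ball (0 : Euc d) 1) := by
  conv_lhs => rw [← mul_one r, volume_ball_mul x 0 hr 1]
  rw [ENNReal.ofReal_pow hr.le, ENNReal.rpow_natCast]

theorem ballAvg_le_maxFn_indicator (g : Euc d → ℝ≥0∞) {x y : Euc d} {r : ℝ} (hr : 0 < r)
    (hx : x ∈ ball y r) :
    ballAvg g y r ≤ ENNReal.ofReal (2 ^ d) * maxFn ((ball y r).indicator g) x := by
  have hv0 := volume_ball_ne_zero y hr
  have hvt := volume_ball_ne_top y r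
  have hsub : ball y r ⊆ ball x (2 * r) := ball_subset_ball' (by linarith [mem_ball'.1 hx])
  have h := setLIntegral_ball_le_maxFn ((ball y r).indicator g) x (r := 2 * r) (by linarith)
  rw [lintegral_indicator measurableSet_ball, Measure.restrict_restrict measurableSet_ball,
    inter_eq_left.2 hsub, volume_ball_mul x y two_pos] at h
  rw [ballAvg, mul_comm, ← div_eq_mul_inv, ENNReal.div_le_iff' hv0 hvt]
  exact h.trans_eq (by ring)

theorem maxFn_le_max_indicator (g : Euc d → ℝ≥0∞) {x y : Euc d} {r : ℝ} (hr : 0 < r)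
    (hx : x ∈ ball y r) :
    maxFn g x ≤ max (maxFn ((ball y (2 * r)).indicator g) x)
      (⨆ k : ℕ, ENNReal.ofReal (4 ^ d) * ballAvg g y (2 ^ k * r)) := by
  refine maxFn_le_iff.2 fun ρ hρ => ?_
  rcases le_or_gt ρ r with hρr | hρr
  · have hsub : ball x ρ ⊆ ball y (2 * r) := ball_subset_ball' (by linarith [mem_ball.1 hx])
    have h := setLIntegral_ball_le_maxFn ((ball y (2 * r)).indicator g) x hρ
    rw [lintegral_indicator measurableSet_ball, Measure.restrict_restrict measurableSet_ball,
      inter_eq_right.2 hsub] at h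
    exact h.trans (by gcongr; exact le_max_left _ _)
  · obtain ⟨n, hn, hn'⟩ := exists_nat_pow_near ((one_le_div hr).2 hρr.le) one_lt_two
    rw [le_div_iff₀ hr] at hn
    rw [div_lt_iff₀ hr, pow_succ] at hn'
    have h1 : (1 : ℝ) ≤ 2 ^ n := one_le_pow₀ one_le_two
    have h1r : r ≤ 2 ^ n * r := le_mul_of_one_le_left hr.le h1
    have hpos : 0 < 2 ^ (n + 2) * r := by positivity
    have hsub : ball x ρ ⊆ ball y (2 ^ (n + 2) * r) := ball_subset_ball' (by
      have := mem_ball.1 hx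
      rw [pow_add]
      linarith)
    have hv0 := volume_ball_ne_zero y hpos
    have hvt := volume_ball_ne_top y (2 ^ (n + 2) * r)
    calc ∫⁻ z in ball x ρ, g z ≤ ∫⁻ z in ball y (2 ^ (n + 2) * r), g z := lintegral_mono_set hsub
      _ = volume (ball y (2 ^ (n + 2) * r)) * ballAvg g y (2 ^ (n + 2) * r) := by
        rw [ballAvg, ← mul_assoc, ENNReal.mul_inv_cancel hv0 hvt, one_mul]
      _ = ENNReal.ofReal (4 ^ d) * volume (ball x (2 ^ n * r)) *
          ballAvg g y (2 ^ (n + 2) * r) := by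
        rw [← volume_ball_mul y x four_pos, show 2 ^ (n + 2) * r = 4 * (2 ^ n * r) by ring]
      _ ≤ ENNReal.ofReal (4 ^ d) * volume (ball x ρ) * ballAvg g y (2 ^ (n + 2) * r) := by
        gcongr
      _ = volume (ball x ρ) * (ENNReal.ofReal (4 ^ d) * ballAvg g y (2 ^ (n + 2) * r)) := by ring
      _ ≤ _ := by
        gcongr
        exact (le_iSup (fun k : ℕ => ENNReal.ofReal (4 ^ d) * ballAvg g y (2 ^ k * r))
          (n + 2)).trans (le_max_right _ _)

theorem maxFn_rpow_le (g : Euc d → ℝ≥0∞) {x y : Euc d} {r q : ℝ} (hq : 0 < q) (hr : 0 < r)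
    (hx : x ∈ ball y r) :
    maxFn g x ^ q ≤ maxFn ((ball y (2 * r)).indicator g) x ^ q +
      ∑' k : ℕ, (ENNReal.ofReal (4 ^ d) * ballAvg g y (2 ^ k * r)) ^ q := by
  rcases le_max_iff.1 (maxFn_le_max_indicator g hr hx) with h | h
  · exact (ENNReal.rpow_le_rpow h hq.le).trans le_self_add
  · refine le_trans ?_ le_add_self
    rw [← ENNReal.le_rpow_inv_iff hq]
    refine h.trans (iSup_le fun k => ?_)
    rw [ENNReal.le_rpow_inv_iff hq]
    exact ENNReal.le_tsum
      (f := fun k : ℕ => (ENNReal.ofReal (4 ^ d) * ballAvg g y (2 ^ k * r)) ^ q) k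

theorem ENNReal.add_rpow_le_two_rpow_mul (a b : ℝ≥0∞) {s : ℝ} (hs : 0 ≤ s) :
    (a + b) ^ s ≤ 2 ^ s * (a ^ s + b ^ s) := by
  calc (a + b) ^ s ≤ (2 * max a b) ^ s := by
        rw [two_mul]
        gcongr
        exacts [le_max_left _ _, le_max_right _ _]
    _ = 2 ^ s * max a b ^ s := ENNReal.mul_rpow_of_nonneg _ _ hs
    _ ≤ _ := by
        gcongr
        rcases max_choice a b with h | h <;> rw [h]
        exacts [le_self_add, le_add_self]

theorem tsum_indicator_rpow {g : ℕ → Euc d → ℝ≥0∞} {p q : ℝ} (hq : 0 < q) (hpq : 0 < p / q)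
    (s : Set (Euc d)) (x : Euc d) :
    (∑' j, s.indicator (g j) x ^ q) ^ (p / q) =
      s.indicator (fun x => (∑' j, g j x ^ q) ^ (p / q)) x := by
  by_cases hx : x ∈ s
  · simp [hx]
  · simp [hx, hq, hpq]

theorem exists_setLIntegral_ball_tsum_maxFn_le {p q a : ℝ} (hd : 0 < d) (hp : 1 < p) (hq : 1 < q)
    (ha : 0 < a) :
    ∃ C : ℝ≥0∞, C ≠ ∞ ∧ ∀ g : ℕ → Euc d → ℝ≥0∞, (∀ j, Measurable (g j)) →
      ∀ (L : ℝ≥0∞) (y : Euc d),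
        (∀ r, 0 < r → ∫⁻ x in ball y r, (∑' j, g j x ^ q) ^ (p / q) ≤
          L * ENNReal.ofReal r ^ (d - a)) →
        ∀ r, 0 < r → ∫⁻ x in ball y r, (∑' j, maxFn (g j) x ^ q) ^ (p / q) ≤
          C * L * ENNReal.ofReal r ^ (d - a) := by
  obtain ⟨C, hC, hFS⟩ := exists_feffermanStein d hp hq
  have hp0 : 0 < p := by linarith
  have hq0 : 0 < q := by linarith
  have hpq : 0 < p / q := by positivity
  have hqp : 0 < q / p := by positivity
  set b := a * (q / p) with hb
  have hb0 : 0 < b := by positivity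
  set v := volume (ball (0 : Euc d) 1) with hv
  have hv0 : v ≠ 0 := volume_ball_ne_zero 0 one_pos
  have hvt : v ≠ ∞ := volume_ball_ne_top 0 1
  set A := ENNReal.ofReal (2 ^ d) ^ p * C with hA
  have hAt : A ≠ ∞ := ENNReal.mul_ne_top (ENNReal.rpow_ne_top_of_nonneg hp0.le (by simp)) hC
  set S : ℝ≥0∞ := ∑' k : ℕ, ((2 : ℝ≥0∞) ^ (-b)) ^ k with hS
  have hSt : S ≠ ∞ := by
    have h2 : (2 : ℝ≥0∞) ^ (-b) < 1 :=
      ENNReal.rpow_lt_one_of_one_lt_of_neg ENNReal.one_lt_two (by linarith)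
    rw [hS, ENNReal.tsum_geometric]
    exact ENNReal.inv_ne_top.2 (tsub_pos_of_lt h2).ne'
  refine ⟨2 ^ (p / q) * (C * 2 ^ (d - a) +
      ENNReal.ofReal (4 ^ d) ^ p * (A * v⁻¹) * S ^ (p / q) * v),
    ?_, fun g hg L y hL r hr => ?_⟩
  · have h1 : (2 : ℝ≥0∞) ^ (p / q) ≠ ∞ := ENNReal.rpow_ne_top_of_nonneg hpq.le (by simp)
    have h2 : (2 : ℝ≥0∞) ^ (d - a) ≠ ∞ := ENNReal.rpow_ne_top_of_ne_zero (by simp) (by simp)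
    have h3 : ENNReal.ofReal (4 ^ d) ^ p ≠ ∞ := ENNReal.rpow_ne_top_of_nonneg hp0.le (by simp)
    have h4 : S ^ (p / q) ≠ ∞ := ENNReal.rpow_ne_top_of_nonneg hpq.le hSt
    have h5 : v⁻¹ ≠ ∞ := ENNReal.inv_ne_top.2 hv0
    finiteness
  set R := ENNReal.ofReal r with hR
  have hR0 : R ≠ 0 := by simpa [hR] using hr
  have hRt : R ≠ ∞ := ENNReal.ofReal_ne_top
  have hlocal : ∀ ρ, 0 < ρ →
      ∫⁻ x, (∑' j, maxFn ((ball y ρ).indicator (g j)) x ^ q) ^ (p / q) ≤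
        C * (L * ENNReal.ofReal ρ ^ (d - a)) := fun ρ hρ => by
    refine (hFS _ fun j => (hg j).indicator measurableSet_ball).trans ?_
    simp only [tsum_indicator_rpow hq0 hpq]
    rw [lintegral_indicator measurableSet_ball]
    gcongr
    exact hL ρ hρ
  have havg : ∀ ρ, 0 < ρ → ∑' j, ballAvg (g j) y ρ ^ q ≤
      (A * v⁻¹ * L) ^ (q / p) * ENNReal.ofReal ρ ^ (-b) := fun ρ hρ => by
    set P := ENNReal.ofReal ρ with hP
    have hP0 : P ≠ 0 := by simpa [hP] using hρ
    have hPt : P ≠ ∞ := ENNReal.ofReal_ne_top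
    have h1 : (∑' j, ballAvg (g j) y ρ ^ q) ^ (p / q) * (P ^ (d : ℝ) * v) ≤
        A * L * P ^ (d - a) :=
      calc (∑' j, ballAvg (g j) y ρ ^ q) ^ (p / q) * (P ^ (d : ℝ) * v)
          = ∫⁻ x in ball y ρ, (∑' j, ballAvg (g j) y ρ ^ q) ^ (p / q) := by
            rw [setLIntegral_const, volume_ball_eq y hρ]
        _ ≤ ∫⁻ x in ball y ρ, ENNReal.ofReal (2 ^ d) ^ p *
              (∑' j, maxFn ((ball y ρ).indicator (g j)) x ^ q) ^ (p / q) := by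
            refine setLIntegral_mono' measurableSet_ball fun x hx => ?_
            have h2 : ENNReal.ofReal (2 ^ d) ^ p = (ENNReal.ofReal (2 ^ d) ^ q) ^ (p / q) := by
              rw [← ENNReal.rpow_mul, mul_div_cancel₀ _ hq0.ne']
            rw [h2, ← ENNReal.mul_rpow_of_nonneg _ _ hpq.le, ← ENNReal.tsum_mul_left]
            refine ENNReal.rpow_le_rpow (ENNReal.tsum_le_tsum fun j => ?_) hpq.le
            rw [← ENNReal.mul_rpow_of_nonneg _ _ hq0.le]
            exact ENNReal.rpow_le_rpow (ballAvg_le_maxFn_indicator (g j) hρ hx) hq0.le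
        _ ≤ ENNReal.ofReal (2 ^ d) ^ p * (C * (L * P ^ (d - a))) := by
            rw [lintegral_const_mul' _ _ (ENNReal.rpow_ne_top_of_nonneg hp0.le (by simp))]
            gcongr
            exact (setLIntegral_le_lintegral _ _).trans (hlocal ρ hρ)
        _ = _ := by ring
    have hPd0 : P ^ (d : ℝ) ≠ 0 := by simp [hP0]
    have hPdt : P ^ (d : ℝ) ≠ ∞ := ENNReal.rpow_ne_top_of_nonneg (by positivity) hPt
    have h2 : (∑' j, ballAvg (g j) y ρ ^ q) ^ (p / q) ≤ A * v⁻¹ * L * P ^ (-a) := by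
      rw [← ENNReal.mul_le_mul_iff_left (mul_ne_zero hPd0 hv0) (ENNReal.mul_ne_top hPdt hvt)]
      refine h1.trans_eq ?_
      calc A * L * P ^ (d - a) = A * L * (P ^ (-a) * P ^ (d : ℝ)) * (v⁻¹ * v) := by
            rw [← ENNReal.rpow_add _ _ hP0 hPt, ENNReal.inv_mul_cancel hv0 hvt, mul_one,
              neg_add_eq_sub]
        _ = _ := by ring
    calc ∑' j, ballAvg (g j) y ρ ^ q
        = ((∑' j, ballAvg (g j) y ρ ^ q) ^ (p / q)) ^ (q / p) := by
          rw [← ENNReal.rpow_mul, div_mul_div_cancel₀ hq0.ne', div_self hp0.ne', ENNReal.rpow_one]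
      _ ≤ (A * v⁻¹ * L * P ^ (-a)) ^ (q / p) := by gcongr
      _ = _ := by
          rw [ENNReal.mul_rpow_of_nonneg _ _ hqp.le, ← ENNReal.rpow_mul, neg_mul]
  set H : ℝ≥0∞ := ENNReal.ofReal (4 ^ d) ^ q * ((A * v⁻¹ * L) ^ (q / p) * (S * R ^ (-b))) with hH
  have hpt : ∀ x ∈ ball y r, ∑' j, maxFn (g j) x ^ q ≤
      ∑' j, maxFn ((ball y (2 * r)).indicator (g j)) x ^ q + H := fun x hx =>
    calc ∑' j, maxFn (g j) x ^ q
        ≤ ∑' j, (maxFn ((ball y (2 * r)).indicator (g j)) x ^ q +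
            ∑' k : ℕ, (ENNReal.ofReal (4 ^ d) * ballAvg (g j) y (2 ^ k * r)) ^ q) :=
          ENNReal.tsum_le_tsum fun j => maxFn_rpow_le (g j) hq0 hr hx
      _ = ∑' j, maxFn ((ball y (2 * r)).indicator (g j)) x ^ q +
            ENNReal.ofReal (4 ^ d) ^ q * ∑' k : ℕ, ∑' j, ballAvg (g j) y (2 ^ k * r) ^ q := by
          rw [ENNReal.tsum_add, ENNReal.tsum_comm]
          simp only [ENNReal.mul_rpow_of_nonneg _ _ hq0.le, ENNReal.tsum_mul_left]
      _ ≤ ∑' j, maxFn ((ball y (2 * r)).indicator (g j)) x ^ q +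
            ENNReal.ofReal (4 ^ d) ^ q * ∑' k : ℕ, (A * v⁻¹ * L) ^ (q / p) *
              (((2 : ℝ≥0∞) ^ (-b)) ^ k * R ^ (-b)) := by
          gcongr with k
          refine (havg (2 ^ k * r) (by positivity)).trans_eq ?_
          have h2k : (2 : ℝ≥0∞) ^ k ≠ ∞ := by simp
          rw [ENNReal.ofReal_mul (by positivity), ENNReal.ofReal_pow zero_le_two,
            ENNReal.ofReal_ofNat, ENNReal.mul_rpow_of_ne_top h2k hRt, ← ENNReal.rpow_natCast,
            ← ENNReal.rpow_natCast, ← ENNReal.rpow_mul, ← ENNReal.rpow_mul, mul_comm (k : ℝ)]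
      _ = _ := by rw [ENNReal.tsum_mul_left, ENNReal.tsum_mul_right]
  have hHp : H ^ (p / q) * (R ^ (d : ℝ) * v) =
      ENNReal.ofReal (4 ^ d) ^ p * (A * v⁻¹) * S ^ (p / q) * v * L * R ^ (d - a) := by
    simp only [hH, ENNReal.mul_rpow_of_nonneg _ _ hpq.le, ← ENNReal.rpow_mul (ENNReal.ofReal _),
      ← ENNReal.rpow_mul R]
    rw [← ENNReal.rpow_mul _ (q / p), mul_div_cancel₀ _ hq0.ne', div_mul_div_cancel₀ hp0.ne',
      div_self hq0.ne', ENNReal.rpow_one,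
      show d - a = -b * (p / q) + d by rw [hb]; field_simp; ring, ENNReal.rpow_add _ _ hR0 hRt]
    ring
  calc ∫⁻ x in ball y r, (∑' j, maxFn (g j) x ^ q) ^ (p / q)
      ≤ ∫⁻ x in ball y r, 2 ^ (p / q) *
          ((∑' j, maxFn ((ball y (2 * r)).indicator (g j)) x ^ q) ^ (p / q) + H ^ (p / q)) :=
        setLIntegral_mono' measurableSet_ball fun x hx =>
          (ENNReal.rpow_le_rpow (hpt x hx) hpq.le).trans
            (ENNReal.add_rpow_le_two_rpow_mul _ _ hpq.le)
    _ = 2 ^ (p / q) * ((∫⁻ x in ball y r,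
          (∑' j, maxFn ((ball y (2 * r)).indicator (g j)) x ^ q) ^ (p / q)) +
            H ^ (p / q) * (R ^ (d : ℝ) * v)) := by
        rw [lintegral_const_mul' _ _ (ENNReal.rpow_ne_top_of_nonneg hpq.le (by simp)),
          lintegral_add_right _ measurable_const, setLIntegral_const, volume_ball_eq y hr]
    _ ≤ 2 ^ (p / q) * (C * (L * ENNReal.ofReal (2 * r) ^ (d - a)) +
          H ^ (p / q) * (R ^ (d : ℝ) * v)) := by
        gcongr
        exact (setLIntegral_le_lintegral _ _).trans (hlocal (2 * r) (by linarith))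
    _ = _ := by
        rw [hHp, ENNReal.ofReal_mul zero_le_two, ENNReal.ofReal_ofNat,
          ENNReal.mul_rpow_of_ne_top (by simp) hRt]
        ring

theorem setLIntegral_ball_rpow_le_morreyNormE {p : ℝ} (hp : 0 < p) (u : ℝ) (F : Euc d → ℝ≥0∞)
    (y : Euc d) {r : ℝ} (hr : 0 < r) :
    ∫⁻ x in ball y r, F x ^ p ≤
      morreyNormE d p u univ F ^ p * ENNReal.ofReal r ^ (d - d * p / u) := by
  set R := ENNReal.ofReal r with hR
  have hR0 : R ≠ 0 := by simpa [hR] using hr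
  have hRt : R ≠ ∞ := ENNReal.ofReal_ne_top
  set e := (d : ℝ) * (1 / u - 1 / p) with he
  have h : R ^ e * (∫⁻ x in ball y r, F x ^ p) ^ (1 / p) ≤ morreyNormE d p u univ F := by
    rw [hR, ENNReal.ofReal_rpow_of_pos hr, ← univ_inter (ball y r)]
    exact le_iSup_of_le y (le_iSup_of_le (mem_univ y) (le_iSup_of_le r (le_iSup_of_le hr le_rfl)))
  have h1 := ENNReal.rpow_le_rpow h hp.le
  rw [ENNReal.mul_rpow_of_nonneg _ _ hp.le, ← ENNReal.rpow_mul, ← ENNReal.rpow_mul,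
    one_div_mul_cancel hp.ne', ENNReal.rpow_one] at h1
  calc ∫⁻ x in ball y r, F x ^ p
      = R ^ (e * p) * (∫⁻ x in ball y r, F x ^ p) * R ^ (d - d * p / u) := by
        rw [mul_right_comm, ← ENNReal.rpow_add _ _ hR0 hRt,
          show e * p + (d - d * p / u) = 0 by rw [he]; field_simp; ring, ENNReal.rpow_zero, one_mul]
    _ ≤ _ := by gcongr

theorem morreyNormE_le_of_setLIntegral_ball_le {p u : ℝ} (hp : 0 < p) {F : Euc d → ℝ≥0∞}
    {C N : ℝ≥0∞} (h : ∀ y r, 0 < r → ∫⁻ x in ball y r, F x ^ p ≤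
      C * N ^ p * ENNReal.ofReal r ^ (d - d * p / u)) :
    morreyNormE d p u univ F ≤ C ^ (1 / p) * N := by
  refine iSup₂_le fun y _ => iSup₂_le fun r hr => ?_
  have hp' : 0 ≤ 1 / p := by positivity
  rw [univ_inter, ← ENNReal.ofReal_rpow_of_pos hr]
  set R := ENNReal.ofReal r with hR
  have hR0 : R ≠ 0 := by simpa [hR] using hr
  have hRt : R ≠ ∞ := ENNReal.ofReal_ne_top
  calc R ^ ((d : ℝ) * (1 / u - 1 / p)) * (∫⁻ x in ball y r, F x ^ p) ^ (1 / p)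
      ≤ R ^ ((d : ℝ) * (1 / u - 1 / p)) * (C * N ^ p * R ^ (d - d * p / u)) ^ (1 / p) := by
        gcongr
        exact h y r hr
    _ = C ^ (1 / p) * N * (R ^ ((d : ℝ) * (1 / u - 1 / p)) * R ^ ((d - d * p / u) * (1 / p))) := by
        rw [ENNReal.mul_rpow_of_nonneg _ _ hp', ENNReal.mul_rpow_of_nonneg _ _ hp',
          ← ENNReal.rpow_mul N, ← ENNReal.rpow_mul R, mul_one_div_cancel hp.ne', ENNReal.rpow_one]
        ring
    _ = _ := by
        rw [← ENNReal.rpow_add _ _ hR0 hRt, show (d : ℝ) * (1 / u - 1 / p) +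
          (d - d * p / u) * (1 / p) = 0 by field_simp; ring, ENNReal.rpow_zero, mul_one]

theorem exists_morreyNormE_tsum_maxFn_le (hd : 0 < d) {p q u : ℝ} (hp : 1 < p) (hq : 1 < q)
    (hu : 0 < u) :
    ∃ C : ℝ≥0∞, C ≠ ∞ ∧ ∀ g : ℕ → Euc d → ℝ≥0∞, (∀ j, Measurable (g j)) →
      morreyNormE d p u univ (fun x => (∑' j, maxFn (g j) x ^ q) ^ (1 / q)) ≤
        C * morreyNormE d p u univ (fun x => (∑' j, g j x ^ q) ^ (1 / q)) := by
  have hp0 : 0 < p := by linarith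
  have hd' : (0 : ℝ) < d := Nat.cast_pos.2 hd
  obtain ⟨C, hC, h⟩ := exists_setLIntegral_ball_tsum_maxFn_le hd hp hq
    (a := d * p / u) (by positivity)
  refine ⟨C ^ (1 / p), ENNReal.rpow_ne_top_of_nonneg (by positivity) hC, fun g hg => ?_⟩
  refine morreyNormE_le_of_setLIntegral_ball_le hp0 fun y r hr => ?_
  have hpow : ∀ t : ℝ≥0∞, (t ^ (1 / q)) ^ p = t ^ (p / q) := fun t => by
    rw [← ENNReal.rpow_mul, one_div_mul_eq_div]
  simp only [hpow]
  refine h g hg _ y (fun ρ hρ => ?_) r hr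
  simpa only [hpow] using setLIntegral_ball_rpow_le_morreyNormE hp0 u
    (fun x => (∑' j, g j x ^ q) ^ (1 / q)) y hρ

theorem morreyNormE_congr_ae (p u : ℝ) {F G : Euc d → ℝ≥0∞} (h : F =ᵐ[volume] G) :
    morreyNormE d p u univ F = morreyNormE d p u univ G := by
  have key : ∀ s, ∫⁻ x in s, F x ^ p = ∫⁻ x in s, G x ^ p := fun s =>
    lintegral_congr_ae (ae_restrict_of_ae (h.mono fun x hx => congrArg (· ^ p) hx))
  simp only [morreyNormE, key]

end Morrey

/-- Vector-valued Hardy–Littlewood maximal inequality in Morrey spaces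
(Tang–Xu): for `1 < q < ∞`, `1 < p ≤ u < ∞`, there is `c > 0` such that for all
sequences of locally integrable functions `f_j` on `ℝ^d`,
`‖(Σ_j (M f_j)^q)^{1/q} | M^u_p(ℝ^d)‖ ≤ c ‖(Σ_j |f_j|^q)^{1/q} | M^u_p(ℝ^d)‖`. -/
theorem statement0 (d : ℕ) (hd : 0 < d) (q p u : ℝ)
    (hq : 1 < q) (hp : 1 < p) (hpu : p ≤ u) :
    ∃ c : ℝ, 0 < c ∧
      ∀ f : ℕ → Euc d → ℂ,
        (∀ j : ℕ, MeasureTheory.LocallyIntegrable (f j) volume) →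
        morreyNormE d p u Set.univ
            (fun x => (∑' j : ℕ, hlMaximal d (f j) x ^ q) ^ (1 / q))
          ≤ ENNReal.ofReal c *
            morreyNormE d p u Set.univ
              (fun x => (∑' j : ℕ, ((‖f j x‖₊ : ℝ≥0∞)) ^ q) ^ (1 / q)) := by
  have hu : 0 < u := by linarith
  obtain ⟨C, hC, h⟩ := exists_morreyNormE_tsum_maxFn_le hd hp hq hu
  refine ⟨C.toReal + 1, by positivity, fun f hf => ?_⟩
  have hm : ∀ j, AEMeasurable (fun x => (‖f j x‖₊ : ℝ≥0∞)) volume := fun j =>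
    (hf j).aestronglyMeasurable.aemeasurable.nnnorm.coe_nnreal_ennreal
  have hmax : ∀ j x, hlMaximal d (f j) x = maxFn ((hm j).mk _) x := fun j x =>
    congrFun (maxFn_congr_ae (hm j).ae_eq_mk) x
  have hsum : (fun x => (∑' j, (‖f j x‖₊ : ℝ≥0∞) ^ q) ^ (1 / q)) =ᵐ[volume]
      fun x => (∑' j, (hm j).mk _ x ^ q) ^ (1 / q) := by
    filter_upwards [ae_all_iff.2 fun j => (hm j).ae_eq_mk] with x hx
    simp only [hx]
  simp only [hmax]
  rw [morreyNormE_congr_ae p u hsum]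
  refine (h _ fun j => (hm j).measurable_mk).trans ?_
  gcongr
  exact (ENNReal.ofReal_toReal hC).symm.le.trans (ENNReal.ofReal_le_ofReal (by linarith))
end
end

section
/- Let d ∈ ℕ, 0 < p ≤ u < ∞ and let Ω ⊆ ℝ^d be a nonempty open set. Let E denote the trivial extension operator, (Ef)(x) = f(x) for x ∈ Ω and (Ef)(x) = 0 for x ∈ ℝ^d \ Ω. Then there exists a constant c > 0, depending only on d, p, u, such that for every f ∈ M^u_p(Ω) one has Ef ∈ M^u_p(ℝ^d) and ‖Ef | M^u_p(ℝ^d)‖ ≤ c · ‖f | M^u_p(Ω)‖. -/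
open MeasureTheory ENNReal Set Metric Filter
open scoped NNReal Topology

noncomputable section

/-- If `p > 0`, integrating the `p`-th power of a zero extension over `B` only sees `Ω ∩ B`. -/
theorem setLIntegral_nnnorm_indicator_rpow {d : ℕ} {p : ℝ} (hp : 0 < p) {Ω : Set (Euc d)}
    (hΩ : MeasurableSet Ω) (B : Set (Euc d)) (f : Euc d → ℂ) :
    ∫⁻ x in B, (‖Ω.indicator f x‖₊ : ℝ≥0∞) ^ p = ∫⁻ x in Ω ∩ B, (‖f x‖₊ : ℝ≥0∞) ^ p := by
  have h : (fun x => (‖Ω.indicator f x‖₊ : ℝ≥0∞) ^ p)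
      = Ω.indicator fun x => (‖f x‖₊ : ℝ≥0∞) ^ p := by
    ext x
    by_cases hx : x ∈ Ω <;> simp [hx, hp]
  rw [h, setLIntegral_indicator hΩ]

/-- Doubling the radius allows balls centred outside `Ω` to be replaced by balls centred in `Ω`. -/
theorem morreyNorm_indicator_le (d : ℕ) {p : ℝ} (hp : 0 < p) (u : ℝ) {Ω : Set (Euc d)}
    (hΩ : MeasurableSet Ω) (f : Euc d → ℂ) :
    morreyNorm d p u Set.univ (Ω.indicator f)
      ≤ ENNReal.ofReal (2 ^ (-((d : ℝ) * (1 / u - 1 / p)))) * morreyNorm d p u Ω f := by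
  unfold morreyNorm morreyNormE
  refine iSup₂_le fun y _ => iSup₂_le fun r hr => ?_
  rw [Set.univ_inter, setLIntegral_nnnorm_indicator_rpow hp hΩ]
  rcases (Ω ∩ ball y r).eq_empty_or_nonempty with he | ⟨z, hzΩ, hzy⟩
  · simp [he, hp]
  have hsub : ball y r ⊆ ball z (2 * r) :=
    ball_subset_ball' (by rw [dist_comm]; linarith [mem_ball.mp hzy])
  set a : ℝ := (d : ℝ) * (1 / u - 1 / p)
  have hr_eq : r ^ a = 2 ^ (-a) * (2 * r) ^ a := by
    rw [Real.mul_rpow two_pos.le hr.le, ← mul_assoc, ← Real.rpow_add two_pos]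
    simp
  calc
    _ ≤ ENNReal.ofReal (r ^ a) *
        (∫⁻ x in Ω ∩ ball z (2 * r), (‖f x‖₊ : ℝ≥0∞) ^ p) ^ (1 / p) := by
      gcongr
    _ = ENNReal.ofReal (2 ^ (-a)) * (ENNReal.ofReal ((2 * r) ^ a) *
        (∫⁻ x in Ω ∩ ball z (2 * r), (‖f x‖₊ : ℝ≥0∞) ^ p) ^ (1 / p)) := by
      rw [hr_eq, ENNReal.ofReal_mul (by positivity), mul_assoc]
    _ ≤ _ := by
      gcongr
      exact le_iSup₂_of_le z hzΩ (le_iSup₂_of_le (2 * r) (by positivity) le_rfl)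

/-- The trivial extension by zero is bounded from `M^u_p(Ω)` to `M^u_p(ℝ^d)`,
with a constant depending only on `d`, `p`, `u`. -/
theorem statement1 (d : ℕ) (hd : 0 < d) (p u : ℝ) (hp : 0 < p) (hpu : p ≤ u) :
    ∃ c : ℝ, 0 < c ∧
      ∀ (Ω : Set (Euc d)), IsOpen Ω → Ω.Nonempty →
        ∀ f : Euc d → ℂ,
          AEMeasurable f (volume.restrict Ω) →
          morreyNorm d p u Ω f < ⊤ →
          morreyNorm d p u Set.univ (Ω.indicator f) < ⊤ ∧
            morreyNorm d p u Set.univ (Ω.indicator f)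
              ≤ ENNReal.ofReal c * morreyNorm d p u Ω f := by
  refine ⟨2 ^ (-((d : ℝ) * (1 / u - 1 / p))), by positivity, fun Ω hΩ _ f _ hf => ?_⟩
  have h := morreyNorm_indicator_le d hp u hΩ.measurableSet f
  exact ⟨h.trans_lt (ENNReal.mul_lt_top ENNReal.ofReal_lt_top hf), h⟩
end
end

section
/- Let d ∈ ℕ, 0 < p ≤ u < ∞ and let Ω ⊆ ℝ^d be a nonempty open set. Then a measurable function f : Ω → ℂ belongs to M^u_p(Ω) if and only if there exists F ∈ M^u_p(ℝ^d) with F|_Ω = f almost everywhere in Ω. Moreover, there is a constant c ≥ 1, depending only on d, p, u, such that for every f ∈ M^u_p(Ω): ‖f | M^u_p(Ω)‖ ≤ inf{‖F | M^u_p(ℝ^d)‖ : F ∈ M^u_p(ℝ^d), F|_Ω = f a.e. in Ω} ≤ c · ‖f | M^u_p(Ω)‖. -/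
open MeasureTheory ENNReal Set Metric Filter
open scoped NNReal Topology

noncomputable section

/-- Enlarging the domain does not decrease the Morrey quasi-norm, and the quasi-norm only sees
almost-everywhere classes. -/
theorem morreyNorm_le_of_subset_of_ae_eq {d : ℕ} {p u : ℝ} (hp : 0 < p) {Ω Ω' : Set (Euc d)}
    (h : Ω ⊆ Ω') {f F : Euc d → ℂ} (hF : ∀ᵐ x ∂volume.restrict Ω, F x = f x) :
    morreyNorm d p u Ω f ≤ morreyNorm d p u Ω' F := by
  unfold morreyNorm morreyNormE
  refine iSup₂_le fun y hy => iSup₂_le fun r hr => ?_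
  refine le_trans ?_ (le_iSup₂_of_le y (h hy) (le_iSup₂_of_le r hr le_rfl))
  refine mul_le_mul' le_rfl (ENNReal.rpow_le_rpow ?_ (by positivity))
  calc ∫⁻ x in Ω ∩ ball y r, (‖f x‖₊ : ℝ≥0∞) ^ p
      = ∫⁻ x in Ω ∩ ball y r, (‖F x‖₊ : ℝ≥0∞) ^ p := by
        refine lintegral_congr_ae ?_
        filter_upwards [ae_restrict_of_ae_restrict_of_subset inter_subset_left hF] with x hx
        rw [hx]
    _ ≤ ∫⁻ x in Ω' ∩ ball y r, (‖F x‖₊ : ℝ≥0∞) ^ p :=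
        lintegral_mono_set (inter_subset_inter_left _ h)

/-- The Morrey quasi-norm of the extension by zero is controlled by the intrinsic quasi-norm. -/
theorem morreyNorm_univ_indicator_le {d : ℕ} {p u : ℝ} (hp : 0 < p) {Ω : Set (Euc d)}
    (hΩ : MeasurableSet Ω) (f : Euc d → ℂ) :
    morreyNorm d p u univ (Ω.indicator f) ≤
      ENNReal.ofReal (2 ^ (-((d : ℝ) * (1 / u - 1 / p)))) * morreyNorm d p u Ω f := by
  set a : ℝ := (d : ℝ) * (1 / u - 1 / p)
  refine iSup₂_le fun y _ => iSup₂_le fun r hr => ?_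
  have hint : ∫⁻ x in univ ∩ ball y r, (‖Ω.indicator f x‖₊ : ℝ≥0∞) ^ p =
      ∫⁻ x in Ω ∩ ball y r, (‖f x‖₊ : ℝ≥0∞) ^ p := by
    rw [univ_inter, ← Measure.restrict_restrict hΩ, ← lintegral_indicator hΩ]
    refine lintegral_congr fun x => ?_
    by_cases hx : x ∈ Ω <;> simp [hx, hp]
  rw [hint]
  rcases (Ω ∩ ball y r).eq_empty_or_nonempty with h | ⟨z, hzΩ, hz⟩
  · simp [h, hp]
  have hsub : ball y r ⊆ ball z (2 * r) := by
    refine ball_subset_ball' ?_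
    rw [mem_ball, dist_comm] at hz
    linarith
  have hr2 : r ^ a = 2 ^ (-a) * (2 * r) ^ a := by
    rw [Real.mul_rpow zero_le_two hr.le, ← mul_assoc, ← Real.rpow_add two_pos]
    simp
  calc ENNReal.ofReal (r ^ a) * (∫⁻ x in Ω ∩ ball y r, (‖f x‖₊ : ℝ≥0∞) ^ p) ^ (1 / p)
      ≤ ENNReal.ofReal (r ^ a) *
          (∫⁻ x in Ω ∩ ball z (2 * r), (‖f x‖₊ : ℝ≥0∞) ^ p) ^ (1 / p) := by
        gcongr
    _ = ENNReal.ofReal (2 ^ (-a)) * (ENNReal.ofReal ((2 * r) ^ a) *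
          (∫⁻ x in Ω ∩ ball z (2 * r), (‖f x‖₊ : ℝ≥0∞) ^ p) ^ (1 / p)) := by
        rw [hr2, ENNReal.ofReal_mul (by positivity), mul_assoc]
    _ ≤ ENNReal.ofReal (2 ^ (-a)) * morreyNorm d p u Ω f := by
        gcongr
        exact le_iSup₂_of_le (f := fun y (_ : y ∈ Ω) => ⨆ (r : ℝ) (_ : 0 < r),
          ENNReal.ofReal (r ^ a) * (∫⁻ x in Ω ∩ ball y r, (‖f x‖₊ : ℝ≥0∞) ^ p) ^ (1 / p))
          z hzΩ (le_iSup₂_of_le (2 * r) (by positivity) le_rfl)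

/-- `M^u_p(Ω)` consists exactly of restrictions (a.e.) of functions in `M^u_p(ℝ^d)`,
and the intrinsic Morrey norm is equivalent to the infimum of norms of extensions. -/
theorem statement2 (d : ℕ) (hd : 0 < d) (p u : ℝ) (hp : 0 < p) (hpu : p ≤ u) :
    ∃ c : ℝ, 1 ≤ c ∧
      ∀ (Ω : Set (Euc d)), IsOpen Ω → Ω.Nonempty →
        ∀ f : Euc d → ℂ, AEMeasurable f (volume.restrict Ω) →
          (morreyNorm d p u Ω f < ⊤ ↔
            ∃ F : Euc d → ℂ, AEMeasurable F volume ∧ morreyNorm d p u Set.univ F < ⊤ ∧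
              ∀ᵐ x ∂volume.restrict Ω, F x = f x) ∧
          (morreyNorm d p u Ω f < ⊤ →
            morreyNorm d p u Ω f
                ≤ (⨅ (F : Euc d → ℂ) (_ : AEMeasurable F volume ∧
                      morreyNorm d p u Set.univ F < ⊤ ∧
                      ∀ᵐ x ∂volume.restrict Ω, F x = f x),
                    morreyNorm d p u Set.univ F) ∧
              (⨅ (F : Euc d → ℂ) (_ : AEMeasurable F volume ∧
                    morreyNorm d p u Set.univ F < ⊤ ∧
                    ∀ᵐ x ∂volume.restrict Ω, F x = f x),
                  morreyNorm d p u Set.univ F)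
                ≤ ENNReal.ofReal c * morreyNorm d p u Ω f) := by
  refine ⟨2 ^ (-((d : ℝ) * (1 / u - 1 / p))), ?_, fun Ω hΩ _ f hf => ?_⟩
  · refine Real.one_le_rpow one_le_two ?_
    have : 1 / u - 1 / p ≤ 0 := sub_nonpos.2 (one_div_le_one_div_of_le hp hpu)
    exact neg_nonneg.2 (mul_nonpos_of_nonneg_of_nonpos d.cast_nonneg this)
  have hext : morreyNorm d p u Ω f < ⊤ → AEMeasurable (Ω.indicator f) volume ∧
      morreyNorm d p u univ (Ω.indicator f) < ⊤ ∧
      ∀ᵐ x ∂volume.restrict Ω, Ω.indicator f x = f x := fun h =>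
    ⟨(aemeasurable_indicator_iff hΩ.measurableSet).2 hf,
      (morreyNorm_univ_indicator_le hp hΩ.measurableSet f).trans_lt
        (ENNReal.mul_lt_top ENNReal.ofReal_lt_top h),
      indicator_ae_eq_restrict hΩ.measurableSet⟩
  refine ⟨⟨fun h => ⟨_, hext h⟩, ?_⟩, fun h => ⟨?_, ?_⟩⟩
  · rintro ⟨F, -, hF, hFf⟩
    exact (morreyNorm_le_of_subset_of_ae_eq hp (subset_univ Ω) hFf).trans_lt hF
  · exact le_iInf₂ fun F hF => morreyNorm_le_of_subset_of_ae_eq hp (subset_univ Ω) hF.2.2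
  · exact iInf₂_le_of_le _ (hext h) (morreyNorm_univ_indicator_le hp hΩ.measurableSet f)
end
end

section
/- Let d ∈ ℕ, 0 < p ≤ u < ∞, let Ω₁, Ω₂ ⊆ ℝ^d be nonempty open sets, and let S ⊆ ℝ^d be a set with S ∩ Ω₁ = S ∩ Ω₂. Then there exists a constant c > 0, depending only on d, p, u, such that for every measurable F : ℝ^d → ℂ vanishing almost everywhere outside S one has ‖F|_{Ω₂} | M^u_p(Ω₂)‖ ≤ c · ‖F|_{Ω₁} | M^u_p(Ω₁)‖ (and by symmetry the two norms are comparable). -/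
open MeasureTheory ENNReal Set Metric Filter
open scoped NNReal Topology

noncomputable section

/-- If `F` vanishes a.e. outside `S` and `S ∩ Ω₁ = S ∩ Ω₂`, then integrals of `|F|^p` over
`Ω₂ ∩ A` are controlled by integrals over `Ω₁ ∩ B` whenever `A ⊆ B`. -/
theorem setLIntegral_enorm_rpow_le_of_inter_eq {α : Type*} [MeasurableSpace α] {μ : Measure α}
    {Ω₁ Ω₂ S A B : Set α} {F : α → ℂ} {p : ℝ} (hp : 0 < p) (h₁ : MeasurableSet (Ω₁ ∩ B))
    (h₂ : MeasurableSet (Ω₂ ∩ A)) (hS : S ∩ Ω₁ = S ∩ Ω₂) (hF : ∀ᵐ x ∂μ, x ∉ S → F x = 0)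
    (hAB : A ⊆ B) :
    ∫⁻ x in Ω₂ ∩ A, (‖F x‖₊ : ℝ≥0∞) ^ p ∂μ ≤ ∫⁻ x in Ω₁ ∩ B, (‖F x‖₊ : ℝ≥0∞) ^ p ∂μ := by
  rw [← lintegral_indicator h₁, ← lintegral_indicator h₂]
  refine lintegral_mono_ae ?_
  filter_upwards [hF] with x hx
  by_cases hxA : x ∈ Ω₂ ∩ A
  · by_cases hxS : x ∈ S
    · have hxΩ : x ∈ S ∩ Ω₁ := hS ▸ ⟨hxS, hxA.1⟩
      rw [indicator_of_mem hxA, indicator_of_mem (show x ∈ Ω₁ ∩ B from ⟨hxΩ.2, hAB hxA.2⟩)]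
    · simp [indicator_of_mem hxA, hx hxS, hp]
  · simp [indicator_of_notMem hxA]

/-- If `S ∩ Ω₁ = S ∩ Ω₂` and `F` vanishes a.e. outside `S`, then the Morrey norms
of (the restrictions of) `F` on `Ω₁` and `Ω₂` are comparable, with a constant
depending only on `d`, `p`, `u`. -/
theorem statement4 (d : ℕ) (hd : 0 < d) (p u : ℝ) (hp : 0 < p) (hpu : p ≤ u) :
    ∃ c : ℝ, 0 < c ∧
      ∀ (Ω₁ Ω₂ : Set (Euc d)),
        IsOpen Ω₁ → Ω₁.Nonempty → IsOpen Ω₂ → Ω₂.Nonempty →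
        ∀ S : Set (Euc d), S ∩ Ω₁ = S ∩ Ω₂ →
          ∀ F : Euc d → ℂ, AEMeasurable F volume →
            (∀ᵐ x ∂(volume : Measure (Euc d)), x ∉ S → F x = 0) →
            morreyNorm d p u Ω₂ F ≤ ENNReal.ofReal c * morreyNorm d p u Ω₁ F := by
  set a : ℝ := (d : ℝ) * (1 / u - 1 / p) with ha
  refine ⟨(2 ^ a)⁻¹, by positivity, ?_⟩
  intro Ω₁ Ω₂ hΩ₁ _ hΩ₂ _ S hS F _ hF
  unfold morreyNorm morreyNormE
  refine iSup₂_le fun y _ => iSup₂_le fun r hr => ?_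
  rw [← ha]
  rcases (Ω₁ ∩ ball y r).eq_empty_or_nonempty with hempty | ⟨z, hzΩ, hzr⟩
  · have h := setLIntegral_enorm_rpow_le_of_inter_eq hp (hΩ₁.inter isOpen_ball).measurableSet
      (hΩ₂.inter isOpen_ball).measurableSet hS hF (Subset.refl (ball y r))
    rw [hempty, Measure.restrict_empty, lintegral_zero_measure, nonpos_iff_eq_zero] at h
    simp [h, hp]
  · have hball : ball y r ⊆ ball z (2 * r) := ball_subset_ball' (by
      have := mem_ball'.1 hzr
      linarith)
    have h := setLIntegral_enorm_rpow_le_of_inter_eq hp (hΩ₁.inter isOpen_ball).measurableSet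
      (hΩ₂.inter isOpen_ball).measurableSet hS hF hball
    have hscale : r ^ a = (2 ^ a)⁻¹ * (2 * r) ^ a := by
      rw [Real.mul_rpow zero_le_two hr.le, inv_mul_cancel_left₀ (by positivity)]
    calc
      _ ≤ ENNReal.ofReal (r ^ a) *
          (∫⁻ x in Ω₁ ∩ ball z (2 * r), (‖F x‖₊ : ℝ≥0∞) ^ p) ^ (1 / p) := by gcongr
      _ = ENNReal.ofReal (2 ^ a)⁻¹ * (ENNReal.ofReal ((2 * r) ^ a) *
          (∫⁻ x in Ω₁ ∩ ball z (2 * r), (‖F x‖₊ : ℝ≥0∞) ^ p) ^ (1 / p)) := by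
        rw [hscale, ENNReal.ofReal_mul (by positivity), mul_assoc]
      _ ≤ _ := by
        gcongr
        exact le_iSup₂_of_le z hzΩ (le_iSup₂_of_le (2 * r) (by positivity) le_rfl)
end
end

section
/- Let d, N ∈ ℕ, let Ω ⊆ ℝ^d be a nonempty open set, x ∈ Ω, t > 0, and let C > 0. Let (p_i)_{i ∈ I} be a finite family of polynomials in 𝒫_{N−1} that is orthonormal with respect to the inner product ⟨f,g⟩_{x,t} := t^{−d} ∫_{B(x,t) ∩ Ω} f(z) · conj(g(z)) dz, whose linear span contains the restriction to B(x,t) ∩ Ω of every polynomial in 𝒫_{N−1}, and which satisfies sup_{y ∈ B(x,t) ∩ Ω} |p_i(y)| ≤ C for all i ∈ I. Define Π f := Σ_{i ∈ I} ⟨f, p_i⟩_{x,t} · p_i. Then there is a constant c₂ > 0, depending only on C, |I| and d, such that for every f ∈ L¹(B(x,t) ∩ Ω): t^{−d} ∫_{B(x,t) ∩ Ω} |f(z) − (Π f)(z)| dz ≤ c₂ · osc_{1,Ω}^{N−1} f(x,t). -/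
open MeasureTheory ENNReal Set Metric Filter
open scoped NNReal Topology

noncomputable section

theorem continuous_of_mem_polyFuns {d N : ℕ} {P : Euc d → ℂ} (hP : P ∈ polyFuns d N) :
    Continuous P := by
  obtain ⟨Q, -, hQ⟩ := hP
  rw [funext hQ]
  exact (MvPolynomial.continuous_eval Q).comp (by fun_prop)

theorem innerXT_add_left {d : ℕ} {Ω : Set (Euc d)} {x : Euc d} {t : ℝ} {f g q : Euc d → ℂ}
    (hf : IntegrableOn (fun z => f z * (starRingEnd ℂ) (q z)) (ball x t ∩ Ω))
    (hg : IntegrableOn (fun z => g z * (starRingEnd ℂ) (q z)) (ball x t ∩ Ω)) :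
    innerXT d Ω x t (fun z => f z + g z) q = innerXT d Ω x t f q + innerXT d Ω x t g q := by
  simp only [innerXT, add_mul]
  rw [integral_add hf hg, mul_add]

theorem innerXT_sum_mul_left {d : ℕ} {Ω : Set (Euc d)} {x : Euc d} {t : ℝ}
    {ι : Type} [Fintype ι] (a : ι → ℂ) {p : ι → Euc d → ℂ} {q : Euc d → ℂ}
    (h : ∀ i, IntegrableOn (fun z => p i z * (starRingEnd ℂ) (q z)) (ball x t ∩ Ω)) :
    innerXT d Ω x t (fun z => ∑ i, a i * p i z) q = ∑ i, a i * innerXT d Ω x t (p i) q := by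
  simp only [innerXT, Finset.sum_mul, mul_assoc]
  rw [integral_finsetSum _ fun i _ => (h i).const_mul (a i), Finset.mul_sum]
  refine Finset.sum_congr rfl fun i _ => ?_
  rw [integral_const_mul]
  ring

theorem innerXT_congr_left {d : ℕ} {Ω : Set (Euc d)} (hΩ : IsOpen Ω) {x : Euc d} {t : ℝ}
    {f g : Euc d → ℂ} (q : Euc d → ℂ) (h : ∀ z ∈ ball x t ∩ Ω, f z = g z) :
    innerXT d Ω x t f q = innerXT d Ω x t g q := by
  unfold innerXT
  congr 1
  exact setIntegral_congr_fun (isOpen_ball.inter hΩ).measurableSet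
    fun z hz => by simp only [h z hz]

theorem norm_innerXT_le {d : ℕ} {Ω : Set (Euc d)} (hΩ : IsOpen Ω) {x : Euc d} {t : ℝ}
    (ht : 0 < t) {C : ℝ} {g q : Euc d → ℂ} (hg : IntegrableOn g (ball x t ∩ Ω))
    (hq : ∀ y ∈ ball x t ∩ Ω, ‖q y‖ ≤ C) :
    ‖innerXT d Ω x t g q‖ ≤ t ^ (-(d : ℝ)) * (C * ∫ z in ball x t ∩ Ω, ‖g z‖) := by
  have hτ : 0 ≤ t ^ (-(d : ℝ)) := (Real.rpow_pos_of_pos ht _).le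
  rw [innerXT, norm_mul, Complex.norm_real, Real.norm_of_nonneg hτ, ← integral_const_mul]
  gcongr
  refine norm_integral_le_of_norm_le (hg.norm.const_mul C) ?_
  refine (ae_restrict_iff' (isOpen_ball.inter hΩ).measurableSet).2 (ae_of_all _ fun z hz => ?_)
  rw [norm_mul, RCLike.norm_conj, mul_comm]
  gcongr
  exact hq z hz

theorem integrableOn_mul_conj {d : ℕ} {Ω : Set (Euc d)} (hΩ : IsOpen Ω) {x : Euc d} {t : ℝ}
    {C : ℝ} {g q : Euc d → ℂ} (hg : IntegrableOn g (ball x t ∩ Ω)) (hqc : Continuous q)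
    (hq : ∀ y ∈ ball x t ∩ Ω, ‖q y‖ ≤ C) :
    IntegrableOn (fun z => g z * (starRingEnd ℂ) (q z)) (ball x t ∩ Ω) := by
  refine Integrable.mul_bdd (c := C) hg (Complex.continuous_conj.comp hqc).aestronglyMeasurable ?_
  refine (ae_restrict_iff' (isOpen_ball.inter hΩ).measurableSet).2 (ae_of_all _ fun z hz => ?_)
  rw [RCLike.norm_conj]
  exact hq z hz

theorem ofReal_rpow_neg_mul_volume_le {d : ℕ} (Ω : Set (Euc d)) (x : Euc d) {t : ℝ}
    (ht : 0 < t) :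
    ENNReal.ofReal (t ^ (-(d : ℝ))) * volume (ball x t ∩ Ω) ≤ volume (ball (0 : Euc d) 1) := by
  calc ENNReal.ofReal (t ^ (-(d : ℝ))) * volume (ball x t ∩ Ω)
      ≤ ENNReal.ofReal (t ^ (-(d : ℝ))) * volume (ball x t) := by gcongr; exact inter_subset_left
    _ = volume (ball (0 : Euc d) 1) := by
      rw [Measure.addHaar_ball_of_pos _ _ ht, ← mul_assoc, finrank_euclideanSpace_fin,
        ← ENNReal.ofReal_mul (Real.rpow_pos_of_pos ht _).le, Real.rpow_neg ht.le,
        Real.rpow_natCast, inv_mul_cancel₀ (pow_pos ht d).ne', ENNReal.ofReal_one, one_mul]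

theorem norm_sub_sum_innerXT_le {d N : ℕ} {Ω : Set (Euc d)} (hΩ : IsOpen Ω) {x : Euc d}
    {t : ℝ} (ht : 0 < t) {C : ℝ} {ι : Type} [Fintype ι] [DecidableEq ι]
    {p : ι → Euc d → ℂ} (hp : ∀ i, p i ∈ polyFuns d N)
    (horth : ∀ i j, innerXT d Ω x t (p i) (p j) = if i = j then 1 else 0)
    (hbd : ∀ i, ∀ y ∈ ball x t ∩ Ω, ‖p i y‖ ≤ C) {f P : Euc d → ℂ}
    (hg : IntegrableOn (fun z => f z - P z) (ball x t ∩ Ω)) {a : ι → ℂ}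
    (ha : ∀ z ∈ ball x t ∩ Ω, P z = ∑ i, a i * p i z) {z : Euc d} (hz : z ∈ ball x t ∩ Ω) :
    ‖f z - ∑ i, innerXT d Ω x t f (p i) * p i z‖ ≤
      ‖f z - P z‖ + Fintype.card ι * C ^ 2 * t ^ (-(d : ℝ)) *
        ∫ y in ball x t ∩ Ω, ‖f y - P y‖ := by
  have hfin : volume (ball x t ∩ Ω) ≠ ⊤ :=
    ((measure_mono inter_subset_left).trans_lt measure_ball_lt_top).ne
  have hpint : ∀ i, IntegrableOn (p i) (ball x t ∩ Ω) := fun i =>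
    IntegrableOn.of_bound hfin.lt_top (continuous_of_mem_polyFuns (hp i)).aestronglyMeasurable C
      ((ae_restrict_iff' (isOpen_ball.inter hΩ).measurableSet).2 (ae_of_all _ (hbd i)))
  have hpp : ∀ i j, IntegrableOn (fun z => p i z * (starRingEnd ℂ) (p j z)) (ball x t ∩ Ω) :=
    fun i j => integrableOn_mul_conj hΩ (hpint i) (continuous_of_mem_polyFuns (hp j)) (hbd j)
  have hcoef : ∀ i, innerXT d Ω x t f (p i) =
      innerXT d Ω x t (fun z => f z - P z) (p i) + a i := by
    intro i
    have h1 : innerXT d Ω x t (fun z => ∑ j, a j * p j z) (p i) = a i := by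
      rw [innerXT_sum_mul_left a fun j => hpp j i]
      simp [horth]
    have h2 : IntegrableOn (fun z => (∑ j, a j * p j z) * (starRingEnd ℂ) (p i z))
        (ball x t ∩ Ω) :=
      integrableOn_mul_conj hΩ (integrable_finsetSum _ fun j _ => (hpint j).const_mul (a j))
        (continuous_of_mem_polyFuns (hp i)) (hbd i)
    rw [← h1, ← innerXT_add_left
      (integrableOn_mul_conj hΩ hg (continuous_of_mem_polyFuns (hp i)) (hbd i)) h2]
    exact innerXT_congr_left hΩ _ fun z hz => by rw [← ha z hz]; ring
  have hrw : f z - ∑ i, innerXT d Ω x t f (p i) * p i z =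
      (f z - P z) - ∑ i, innerXT d Ω x t (fun z => f z - P z) (p i) * p i z := by
    simp only [hcoef, add_mul, Finset.sum_add_distrib]
    rw [ha z hz]
    ring
  rw [hrw]
  refine (norm_sub_le _ _).trans (add_le_add_right ?_ _)
  calc ‖∑ i, innerXT d Ω x t (fun z => f z - P z) (p i) * p i z‖
      ≤ ∑ _i : ι, t ^ (-(d : ℝ)) * (C * ∫ y in ball x t ∩ Ω, ‖f y - P y‖) * C := by
        refine norm_sum_le_of_le _ fun i _ => ?_
        rw [norm_mul]
        exact mul_le_mul (norm_innerXT_le hΩ ht hg (hbd i)) (hbd i z hz) (norm_nonneg _)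
          ((norm_nonneg _).trans (norm_innerXT_le hΩ ht hg (hbd i)))
    _ = _ := by
        rw [Finset.sum_const, Finset.card_univ, nsmul_eq_mul]
        ring

open scoped Classical in
/-- Quasi-optimality of the projection onto polynomials: with a constant `c₂`
depending only on `C`, `|I|` and `d`, one has
`t^{-d} ∫_{B(x,t) ∩ Ω} |f - Π f| ≤ c₂ · osc_{1,Ω}^{N-1} f(x,t)`. -/
theorem statement8 (d : ℕ) (hd : 0 < d) (C : ℝ) (hC : 0 < C)
    {ι : Type} [Fintype ι] :
    ∃ c₂ : ℝ, 0 < c₂ ∧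
      ∀ (N : ℕ), 0 < N →
      ∀ (Ω : Set (Euc d)), IsOpen Ω → Ω.Nonempty →
      ∀ x ∈ Ω, ∀ t : ℝ, 0 < t →
      ∀ p : ι → Euc d → ℂ,
        (∀ i, p i ∈ polyFuns d N) →
        (∀ i j, innerXT d Ω x t (p i) (p j) = if i = j then 1 else 0) →
        (∀ Q ∈ polyFuns d N, ∃ a : ι → ℂ,
          ∀ z ∈ Metric.ball x t ∩ Ω, Q z = ∑ i, a i * p i z) →
        (∀ i, ∀ y ∈ Metric.ball x t ∩ Ω, ‖p i y‖ ≤ C) →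
      ∀ f : Euc d → ℂ, MeasureTheory.IntegrableOn f (Metric.ball x t ∩ Ω) volume →
        ENNReal.ofReal (t ^ (-(d : ℝ))) *
            (∫⁻ z in Metric.ball x t ∩ Ω,
              (‖f z - ∑ i, innerXT d Ω x t f (p i) * p i z‖₊ : ℝ≥0∞))
          ≤ ENNReal.ofReal c₂ * osc d N 1 Ω f x t := by
  have hV : volume (ball (0 : Euc d) 1) ≠ ⊤ := measure_ball_lt_top.ne
  set V : ℝ := (volume (ball (0 : Euc d) 1)).toReal with hVdef
  have hV0 : 0 ≤ V := ENNReal.toReal_nonneg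
  set M : ℝ := Fintype.card ι * C ^ 2 with hM
  have hM0 : 0 ≤ M := by positivity
  have hc : 0 < 1 + M * V := by positivity
  refine ⟨1 + M * V, hc, ?_⟩
  intro N _ Ω hΩ _ x _ t ht p hp horth hspan hbd f hf
  have hA : MeasurableSet (ball x t ∩ Ω) := (isOpen_ball.inter hΩ).measurableSet
  have hfin : volume (ball x t ∩ Ω) ≠ ⊤ :=
    ((measure_mono inter_subset_left).trans_lt measure_ball_lt_top).ne
  have hc0 : ENNReal.ofReal (1 + M * V) ≠ 0 := (ENNReal.ofReal_pos.2 hc).ne'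
  simp only [osc, ENNReal.mul_iInf_of_ne hc0 ENNReal.ofReal_ne_top, div_one, ENNReal.rpow_one]
  refine le_iInf₂ fun P hP => ?_
  obtain ⟨a, ha⟩ := hspan P hP
  have hPint : IntegrableOn P (ball x t ∩ Ω) :=
    ((continuous_of_mem_polyFuns hP).continuousOn.integrableOn_compact
      (isCompact_closedBall x t)).mono_set (inter_subset_left.trans ball_subset_closedBall)
  have hg : IntegrableOn (fun z => f z - P z) (ball x t ∩ Ω) := hf.sub hPint
  have hτ : 0 ≤ t ^ (-(d : ℝ)) := (Real.rpow_pos_of_pos ht _).le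
  set τ : ℝ := t ^ (-(d : ℝ)) with hτdef
  set L : ℝ≥0∞ := ∫⁻ y in ball x t ∩ Ω, (‖f y - P y‖₊ : ℝ≥0∞) with hL
  have hG : ENNReal.ofReal (∫ y in ball x t ∩ Ω, ‖f y - P y‖) = L :=
    ofReal_integral_norm_eq_lintegral_enorm hg
  have hpt : ∀ z ∈ ball x t ∩ Ω,
      (‖f z - ∑ i, innerXT d Ω x t f (p i) * p i z‖₊ : ℝ≥0∞) ≤
        ‖f z - P z‖₊ + ENNReal.ofReal (M * τ) * L := by
    intro z hz
    have h := norm_sub_sum_innerXT_le hΩ ht hp horth hbd hg ha hz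
    have h' := ENNReal.ofReal_le_ofReal h
    rw [ENNReal.ofReal_add (norm_nonneg _) (by positivity), ENNReal.ofReal_mul (by positivity),
      hG, ofReal_norm, ofReal_norm] at h'
    exact h'
  calc ENNReal.ofReal τ * ∫⁻ z in ball x t ∩ Ω,
          (‖f z - ∑ i, innerXT d Ω x t f (p i) * p i z‖₊ : ℝ≥0∞)
      ≤ ENNReal.ofReal τ * ∫⁻ z in ball x t ∩ Ω,
          ((‖f z - P z‖₊ : ℝ≥0∞) + ENNReal.ofReal (M * τ) * L) := by
        gcongr ENNReal.ofReal τ * ?_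
        exact setLIntegral_mono' hA hpt
    _ = ENNReal.ofReal τ * (L + ENNReal.ofReal (M * τ) * L * volume (ball x t ∩ Ω)) := by
        rw [lintegral_add_right _ measurable_const, setLIntegral_const]
    _ = (1 + ENNReal.ofReal M * (ENNReal.ofReal τ * volume (ball x t ∩ Ω))) *
          (ENNReal.ofReal τ * L) := by
        rw [ENNReal.ofReal_mul hM0]
        ring
    _ ≤ (1 + ENNReal.ofReal M * volume (ball (0 : Euc d) 1)) * (ENNReal.ofReal τ * L) := by
        gcongr
        exact ofReal_rpow_neg_mul_volume_le Ω x ht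
    _ = ENNReal.ofReal (1 + M * V) * (ENNReal.ofReal τ * L) := by
        rw [ENNReal.ofReal_add zero_le_one (by positivity), ENNReal.ofReal_one,
          ENNReal.ofReal_mul hM0, hVdef, ENNReal.ofReal_toReal hV]
end
end

section
/- Let d, N ∈ ℕ, 0 < q < ∞, 0 < v < ∞, s > 0 and 0 < T ≤ 1. Then there exists a constant c > 0, depending only on d, N, q, v, s (but not on T, f or x), such that for every locally v-integrable f : ℝ^d → ℂ and every x ∈ ℝ^d: (∫_0^T [t^{−s} · osc_v^{N−1} f(x,t)]^q dt/t)^{1/q} ≤ c · ( (∫_{B(x,1)} |f(y)|^v dy)^{q/v} + Σ_{j=1}^∞ 2^{j(s + d/v)q} · inf_{P ∈ 𝒫_{N−1}} (∫_{B(x,2^{−j})} |f(y) − P(y)|^v dy)^{q/v} )^{1/q}. -/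
open MeasureTheory ENNReal Set Metric Filter
open scoped NNReal Topology

noncomputable section

/-- The `(q/v)`-th power of the best polynomial approximation error of `f` on `B(x,r)`. -/
def approxError (d N : ℕ) (q v : ℝ) (f : Euc d → ℂ) (x : Euc d) (r : ℝ) : ℝ≥0∞ :=
  ⨅ (P : Euc d → ℂ) (_ : P ∈ polyFuns d N),
    (∫⁻ y in Metric.ball x r, (‖f y - P y‖₊ : ℝ≥0∞) ^ v) ^ (q / v)

theorem zero_mem_polyFuns {d N : ℕ} (hN : 0 < N) : (fun _ : Euc d => (0 : ℂ)) ∈ polyFuns d N :=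
  ⟨0, by simpa using hN, fun x => by simp⟩

theorem approxError_le_lintegral {d N : ℕ} (hN : 0 < N) (q v : ℝ) (f : Euc d → ℂ) (x : Euc d)
    (r : ℝ) :
    approxError d N q v f x r ≤
      (∫⁻ y in Metric.ball x r, (‖f y‖₊ : ℝ≥0∞) ^ v) ^ (q / v) := by
  refine (iInf₂_le _ (zero_mem_polyFuns hN)).trans (le_of_eq ?_)
  simp

/-- Pointwise control of the scaled oscillation at scale `t ∈ (r, R]` by the approximation
error on the larger ball. -/
theorem rpow_mul_osc_le {d N : ℕ} {q v s r R t : ℝ} (hq : 0 < q) (hv : 0 < v) (hs : 0 < s)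
    (hr : 0 < r) (hrt : r < t) (htR : t ≤ R) (f : Euc d → ℂ) (x : Euc d) :
    (ENNReal.ofReal (t ^ (-s)) * osc d N v Set.univ f x t) ^ q ≤
      ENNReal.ofReal (r ^ (-((s + (d : ℝ) / v) * q))) * approxError d N q v f x R := by
  have ht : 0 < t := hr.trans hrt
  unfold approxError
  have hc : ENNReal.ofReal (r ^ (-((s + (d : ℝ) / v) * q))) ≠ 0 := by
    rw [Ne, ENNReal.ofReal_eq_zero, not_le]; positivity
  rw [ENNReal.mul_iInf_of_ne hc ENNReal.ofReal_ne_top]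
  refine le_iInf fun P => ?_
  rw [ENNReal.mul_iInf_of_ne hc ENNReal.ofReal_ne_top]
  refine le_iInf fun hP => ?_
  set J := ∫⁻ y in Metric.ball x R, (‖f y - P y‖₊ : ℝ≥0∞) ^ v with hJ
  have h1 : osc d N v Set.univ f x t ≤ (ENNReal.ofReal (r ^ (-(d : ℝ))) * J) ^ (1 / v) := by
    refine (iInf₂_le P hP).trans ?_
    refine ENNReal.rpow_le_rpow (mul_le_mul' ?_ ?_) (by positivity)
    · exact ENNReal.ofReal_le_ofReal
        (Real.rpow_le_rpow_of_nonpos hr hrt.le (by simp))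
    · rw [hJ]
      exact lintegral_mono_set (inter_subset_left.trans (Metric.ball_subset_ball htR))
  have h2 : ENNReal.ofReal (t ^ (-s)) ≤ ENNReal.ofReal (r ^ (-s)) :=
    ENNReal.ofReal_le_ofReal (Real.rpow_le_rpow_of_nonpos hr hrt.le (by linarith))
  refine (ENNReal.rpow_le_rpow (mul_le_mul' h2 h1) hq.le).trans (le_of_eq ?_)
  rw [ENNReal.mul_rpow_of_nonneg _ _ hq.le, ← ENNReal.rpow_mul,
    ENNReal.mul_rpow_of_nonneg _ _ (by positivity), ← mul_assoc,
    ENNReal.ofReal_rpow_of_pos (by positivity), ENNReal.ofReal_rpow_of_pos (by positivity),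
    ← ENNReal.ofReal_mul (by positivity), ← Real.rpow_mul hr.le, ← Real.rpow_mul hr.le,
    ← Real.rpow_add hr]
  rw [one_div_mul_eq_div]
  congr 3
  ring

/-- The contribution of a dyadic shell `(r, 2 r]` to the continuous oscillation quasi-norm. -/
theorem lintegral_shell_osc_le {d N : ℕ} {q v s r : ℝ} (hq : 0 < q) (hv : 0 < v) (hs : 0 < s)
    (hr : 0 < r) (f : Euc d → ℂ) (x : Euc d) :
    ∫⁻ t in Set.Ioc r (2 * r), (ENNReal.ofReal (t ^ (-s)) * osc d N v Set.univ f x t) ^ q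
        * ENNReal.ofReal (1 / t) ≤
      ENNReal.ofReal (r ^ (-((s + (d : ℝ) / v) * q))) * approxError d N q v f x (2 * r) := by
  set A := ENNReal.ofReal (r ^ (-((s + (d : ℝ) / v) * q))) * approxError d N q v f x (2 * r)
  calc _ ≤ ∫⁻ _ in Set.Ioc r (2 * r), A * ENNReal.ofReal (1 / r) := by
        refine setLIntegral_mono' measurableSet_Ioc fun t ht => ?_
        exact mul_le_mul' (rpow_mul_osc_le hq hv hs hr ht.1 ht.2 f x)
          (ENNReal.ofReal_le_ofReal (one_div_le_one_div_of_le hr ht.1.le))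
    _ = A := by
        rw [setLIntegral_const, Real.volume_Ioc, mul_assoc, ← ENNReal.ofReal_mul (by positivity)]
        have : 1 / r * (2 * r - r) = 1 := by field_simp; ring
        rw [this, ENNReal.ofReal_one, mul_one]

theorem Ioo_subset_iUnion_dyadic {T : ℝ} (hT : T ≤ 1) :
    Set.Ioo (0 : ℝ) T ⊆
      ⋃ j : ℕ, Set.Ioc ((2 : ℝ) ^ (-((j : ℝ) + 1))) (2 * (2 : ℝ) ^ (-((j : ℝ) + 1))) := by
  intro t ht
  obtain ⟨n, hn1, hn2⟩ := exists_nat_pow_near_of_lt_one ht.1 (ht.2.le.trans hT)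
    (show (0 : ℝ) < 1 / 2 by norm_num) (by norm_num)
  have h : (2 : ℝ) ^ (-((n : ℝ) + 1)) = (1 / 2) ^ (n + 1) := by
    rw [Real.rpow_neg zero_le_two, ← Nat.cast_succ, Real.rpow_natCast, one_div, inv_pow]
  refine mem_iUnion.2 ⟨n, ?_, ?_⟩
  · rwa [h]
  · rw [h, pow_succ]
    linarith

/-- Discretization estimate (upper bound) for the continuous oscillation
quasi-norm by the dyadic one, with a constant independent of `T`, `f`, `x`. -/
theorem statement10 (d N : ℕ) (hd : 0 < d) (hN : 0 < N)
    (q v s : ℝ) (hq : 0 < q) (hv : 0 < v) (hs : 0 < s) :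
    ∃ c : ℝ, 0 < c ∧
      ∀ T : ℝ, 0 < T → T ≤ 1 →
      ∀ f : Euc d → ℂ, MemLvLoc d v Set.univ f →
      ∀ x : Euc d,
        (∫⁻ t in Set.Ioo (0 : ℝ) T,
            (ENNReal.ofReal (t ^ (-s)) * osc d N v Set.univ f x t) ^ q
              * ENNReal.ofReal (1 / t)) ^ (1 / q)
          ≤ ENNReal.ofReal c *
            ((∫⁻ y in Metric.ball x 1, (‖f y‖₊ : ℝ≥0∞) ^ v) ^ (q / v)
              + ∑' j : ℕ,
                  ENNReal.ofReal ((2 : ℝ) ^ (((j : ℝ) + 1) * (s + (d : ℝ) / v) * q)) *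
                    ⨅ (P : Euc d → ℂ) (_ : P ∈ polyFuns d N),
                      (∫⁻ y in Metric.ball x ((2 : ℝ) ^ (-((j : ℝ) + 1))),
                        (‖f y - P y‖₊ : ℝ≥0∞) ^ v) ^ (q / v)) ^ (1 / q) := by
  refine ⟨2 ^ (s + (d : ℝ) / v), by positivity, fun T _ hT1 f _ x => ?_⟩
  set σ := (s + (d : ℝ) / v) * q with hσ
  have key : (∫⁻ t in Set.Ioo (0 : ℝ) T,
      (ENNReal.ofReal (t ^ (-s)) * osc d N v Set.univ f x t) ^ q * ENNReal.ofReal (1 / t)) ≤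
      ENNReal.ofReal (2 ^ σ) * ((∫⁻ y in Metric.ball x 1, (‖f y‖₊ : ℝ≥0∞) ^ v) ^ (q / v)
        + ∑' j : ℕ, ENNReal.ofReal ((2 : ℝ) ^ (((j : ℝ) + 1) * (s + (d : ℝ) / v) * q)) *
            approxError d N q v f x ((2 : ℝ) ^ (-((j : ℝ) + 1)))) := by
    calc _ ≤ ∑' j : ℕ, ENNReal.ofReal (((2 : ℝ) ^ (-((j : ℝ) + 1))) ^ (-σ)) *
            approxError d N q v f x (2 * (2 : ℝ) ^ (-((j : ℝ) + 1))) :=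
          (lintegral_mono_set (Ioo_subset_iUnion_dyadic hT1)).trans <|
            (lintegral_iUnion_le _ _).trans <| ENNReal.tsum_le_tsum fun j =>
              lintegral_shell_osc_le hq hv hs (by positivity) f x
      _ = ∑' j : ℕ, ENNReal.ofReal (2 ^ σ) * (ENNReal.ofReal (2 ^ ((j : ℝ) * σ)) *
            approxError d N q v f x ((2 : ℝ) ^ (-(j : ℝ)))) := by
          refine tsum_congr fun j => ?_
          rw [← mul_assoc, ← ENNReal.ofReal_mul (by positivity), ← Real.rpow_mul zero_le_two,
            ← Real.rpow_add zero_lt_two]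
          have h : 2 * (2 : ℝ) ^ (-((j : ℝ) + 1)) = 2 ^ (-(j : ℝ)) := by
            nth_rewrite 1 [← Real.rpow_one (2 : ℝ)]
            rw [← Real.rpow_add zero_lt_two]
            congr 1
            ring
          rw [h]
          congr 3
          ring
      _ ≤ _ := by
          rw [ENNReal.tsum_mul_left, tsum_eq_zero_add' ENNReal.summable]
          refine mul_le_mul_right (add_le_add ?_ (le_of_eq ?_)) _
          · simpa using approxError_le_lintegral hN q v f x 1
          · refine tsum_congr fun j => ?_
            rw [hσ, ← mul_assoc]
            push_cast
            rfl
  refine (ENNReal.rpow_le_rpow key (by positivity)).trans (le_of_eq ?_)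
  rw [ENNReal.mul_rpow_of_nonneg _ _ (by positivity), ENNReal.ofReal_rpow_of_pos (by positivity),
    ← Real.rpow_mul zero_le_two, hσ, mul_assoc, mul_one_div_cancel hq.ne', mul_one]
  rfl
end
end

section
/- Let d, N ∈ ℕ, 0 < q < ∞, 0 < v < ∞, s > 0 and 0 < T ≤ 1. Then there exists a constant c > 0, depending only on d, N, q, v, s and T, such that for every locally v-integrable f : ℝ^d → ℂ and every x ∈ ℝ^d: ( (∫_{B(x,1)} |f(y)|^v dy)^{q/v} + Σ_{j=1}^∞ 2^{j(s + d/v)q} · inf_{P ∈ 𝒫_{N−1}} (∫_{B(x,2^{−j})} |f(y) − P(y)|^v dy)^{q/v} )^{1/q} ≤ c · ( (∫_{B(x,1)} |f(y)|^v dy)^{1/v} + (∫_0^T [t^{−s} · osc_v^{N−1} f(x,t)]^q dt/t)^{1/q} ). -/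
open MeasureTheory ENNReal Set Metric Filter
open scoped NNReal Topology

noncomputable section

/-- The error of best `L^v` approximation of `f` on `B(x, r)` by polynomials of degree `< N`,
raised to the power `v`. -/
def polyError (d N : ℕ) (v : ℝ) (f : Euc d → ℂ) (x : Euc d) (r : ℝ) : ℝ≥0∞ :=
  ⨅ (P : Euc d → ℂ) (_ : P ∈ polyFuns d N),
    ∫⁻ y in Metric.ball x r, (‖f y - P y‖₊ : ℝ≥0∞) ^ v

lemma polyError_mono (d N : ℕ) (v : ℝ) (f : Euc d → ℂ) (x : Euc d) :
    Monotone (polyError d N v f x) := fun _ _ h =>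
  iInf₂_mono fun _ _ => lintegral_mono_set (Metric.ball_subset_ball h)

lemma polyError_le {d N : ℕ} (hN : 0 < N) (v : ℝ) (f : Euc d → ℂ) (x : Euc d) (r : ℝ) :
    polyError d N v f x r ≤ ∫⁻ y in Metric.ball x r, (‖f y‖₊ : ℝ≥0∞) ^ v := by
  refine (iInf₂_le (fun _ => 0) ⟨0, by simpa using hN, by simp⟩).trans ?_
  simp

lemma iInf_rpow_eq_polyError_rpow (d N : ℕ) (v : ℝ) (f : Euc d → ℂ) (x : Euc d) (r : ℝ)
    {p : ℝ} (hp : 0 < p) :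
    ⨅ (P : Euc d → ℂ) (_ : P ∈ polyFuns d N),
      (∫⁻ y in Metric.ball x r, (‖f y - P y‖₊ : ℝ≥0∞) ^ v) ^ p = polyError d N v f x r ^ p := by
  simp only [polyError, ← ENNReal.orderIsoRpow_apply p hp, OrderIso.map_iInf]

lemma rpow_mul_polyError_le_osc (d N : ℕ) {v : ℝ} (hv : 0 < v) (f : Euc d → ℂ) (x : Euc d)
    (t : ℝ) :
    (ENNReal.ofReal (t ^ (-(d : ℝ))) * polyError d N v f x t) ^ (1 / v)
      ≤ osc d N v Set.univ f x t := by
  refine le_iInf₂ fun P hP => ?_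
  rw [Set.inter_univ]
  gcongr
  exact iInf₂_le P hP

/-- The integrand of the continuous oscillation quasi-norm. -/
def oscIntegrand (d N : ℕ) (q v s : ℝ) (f : Euc d → ℂ) (x : Euc d) (t : ℝ) : ℝ≥0∞ :=
  (ENNReal.ofReal (t ^ (-s)) * osc d N v Set.univ f x t) ^ q * ENNReal.ofReal (1 / t)

lemma le_oscIntegrand (d N : ℕ) {q v s : ℝ} (hq : 0 < q) (hv : 0 < v) (hs : 0 < s)
    (f : Euc d → ℂ) (x : Euc d) {ρ t : ℝ} (hρ : 0 < ρ) (ht : t ∈ Set.Ico (ρ / 2) ρ) :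
    (ENNReal.ofReal (ρ ^ (-s)) * (ENNReal.ofReal (ρ ^ (-(d : ℝ))) *
      polyError d N v f x (ρ / 2)) ^ (1 / v)) ^ q * ENNReal.ofReal (1 / ρ)
      ≤ oscIntegrand d N q v s f x t := by
  have ht0 : 0 < t := lt_of_lt_of_le (by positivity) ht.1
  have hle : t ≤ ρ := ht.2.le
  unfold oscIntegrand
  refine mul_le_mul' (ENNReal.rpow_le_rpow (mul_le_mul' ?_ ?_) hq.le) ?_
  · exact ENNReal.ofReal_le_ofReal
      (Real.rpow_le_rpow_of_nonpos ht0 hle (by linarith))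
  · refine le_trans ?_ (rpow_mul_polyError_le_osc d N hv f x t)
    refine ENNReal.rpow_le_rpow (mul_le_mul' ?_ (polyError_mono d N v f x ht.1)) (by positivity)
    exact ENNReal.ofReal_le_ofReal
      (Real.rpow_le_rpow_of_nonpos ht0 hle (by simp))
  · exact ENNReal.ofReal_le_ofReal (one_div_le_one_div_of_le ht0 hle)

lemma polyError_le_setLIntegral_oscIntegrand (d N : ℕ) {q v s : ℝ} (hq : 0 < q) (hv : 0 < v)
    (hs : 0 < s) (f : Euc d → ℂ) (x : Euc d) {ρ : ℝ} (hρ : 0 < ρ) :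
    ENNReal.ofReal ((ρ / 2) ^ (-((s + d / v) * q))) * polyError d N v f x (ρ / 2) ^ (q / v)
      ≤ ENNReal.ofReal (2 * 2 ^ ((s + d / v) * q)) *
        ∫⁻ t in Set.Ico (ρ / 2) ρ, oscIntegrand d N q v s f x t := by
  set E := polyError d N v f x (ρ / 2) with hE
  have key : (ENNReal.ofReal (ρ ^ (-s)) * (ENNReal.ofReal (ρ ^ (-(d : ℝ))) *
      E) ^ (1 / v)) ^ q * ENNReal.ofReal (1 / ρ) * ENNReal.ofReal (ρ / 2)
      ≤ ∫⁻ t in Set.Ico (ρ / 2) ρ, oscIntegrand d N q v s f x t := by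
    have := setLIntegral_mono' (μ := volume) (measurableSet_Ico (a := ρ / 2) (b := ρ))
      fun t ht => le_oscIntegrand d N hq hv hs f x hρ ht
    rw [setLIntegral_const, Real.volume_Ico, show ρ - ρ / 2 = ρ / 2 by ring] at this
    exact this
  refine le_trans (le_of_eq ?_) (mul_le_mul_right key _)
  rw [ENNReal.mul_rpow_of_nonneg _ _ (by positivity : 0 ≤ 1 / v),
    ENNReal.mul_rpow_of_nonneg _ _ hq.le, ENNReal.mul_rpow_of_nonneg _ _ hq.le,
    ← ENNReal.rpow_mul, ← ENNReal.rpow_mul, show 1 / v * q = q / v by ring,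
    ENNReal.ofReal_rpow_of_pos (by positivity), ENNReal.ofReal_rpow_of_pos (by positivity)]
  have hreal : (ρ / 2) ^ (-((s + d / v) * q)) = 2 * 2 ^ ((s + d / v) * q) *
      ((ρ ^ (-s)) ^ q * (ρ ^ (-(d : ℝ))) ^ (q / v) * (1 / ρ) * (ρ / 2)) := by
    rw [Real.div_rpow hρ.le (by norm_num), ← Real.rpow_mul hρ.le, ← Real.rpow_mul hρ.le,
      ← Real.rpow_add hρ, Real.rpow_neg (by norm_num : (0 : ℝ) ≤ 2),
      show -s * q + -(d : ℝ) * (q / v) = -((s + d / v) * q) by ring]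
    field_simp
  rw [hreal, ENNReal.ofReal_mul (by positivity), ENNReal.ofReal_mul (by positivity),
    ENNReal.ofReal_mul (by positivity), ENNReal.ofReal_mul (by positivity),
    ENNReal.ofReal_mul (by positivity)]
  ring

lemma tsum_setLIntegral_dyadic_le (g : ℝ → ℝ≥0∞) {T : ℝ} {m : ℕ}
    (hm : (2 : ℝ) ^ (-(m : ℝ)) ≤ T) :
    ∑' j : ℕ, ∫⁻ t in Set.Ico ((2 : ℝ) ^ (-((j + m : ℕ) : ℝ)) / 2) (2 ^ (-((j + m : ℕ) : ℝ))), g t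
      ≤ ∫⁻ t in Set.Ioo 0 T, g t := by
  have hmono : Antitone fun j : ℕ => (2 : ℝ) ^ (-((j + m : ℕ) : ℝ)) := fun i j hij =>
    Real.rpow_le_rpow_of_exponent_le (by norm_num) (by push_cast; gcongr)
  have hhalf : ∀ j : ℕ, (2 : ℝ) ^ (-((j + m : ℕ) : ℝ)) / 2 = 2 ^ (-((j + 1 + m : ℕ) : ℝ)) := by
    intro j
    rw [show -((j + 1 + m : ℕ) : ℝ) = -((j + m : ℕ) : ℝ) - 1 by push_cast; ring,
      Real.rpow_sub_one (by norm_num)]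
  simp only [hhalf]
  rw [← lintegral_iUnion (fun _ => measurableSet_Ico)]
  · refine lintegral_mono_set (Set.iUnion_subset fun j t ht => ⟨?_, ?_⟩)
    · exact lt_of_lt_of_le (by positivity) ht.1
    · refine lt_of_lt_of_le ht.2 ((hmono (Nat.zero_le j)).trans ?_)
      simpa using hm
  · simpa using hmono.pairwise_disjoint_on_Ico_succ

/-- Discretization estimate (lower bound): the dyadic oscillation quasi-norm is
bounded by the ball mean plus the continuous oscillation quasi-norm, with a
constant depending only on `d`, `N`, `q`, `v`, `s` and `T`. -/
theorem statement11 (d N : ℕ) (hd : 0 < d) (hN : 0 < N)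
    (q v s T : ℝ) (hq : 0 < q) (hv : 0 < v) (hs : 0 < s) (hT : 0 < T) (hT1 : T ≤ 1) :
    ∃ c : ℝ, 0 < c ∧
      ∀ f : Euc d → ℂ, MemLvLoc d v Set.univ f →
      ∀ x : Euc d,
        ((∫⁻ y in Metric.ball x 1, (‖f y‖₊ : ℝ≥0∞) ^ v) ^ (q / v)
            + ∑' j : ℕ,
                ENNReal.ofReal ((2 : ℝ) ^ (((j : ℝ) + 1) * (s + (d : ℝ) / v) * q)) *
                  ⨅ (P : Euc d → ℂ) (_ : P ∈ polyFuns d N),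
                    (∫⁻ y in Metric.ball x ((2 : ℝ) ^ (-((j : ℝ) + 1))),
                      (‖f y - P y‖₊ : ℝ≥0∞) ^ v) ^ (q / v)) ^ (1 / q)
          ≤ ENNReal.ofReal c *
            ((∫⁻ y in Metric.ball x 1, (‖f y‖₊ : ℝ≥0∞) ^ v) ^ (1 / v)
              + (∫⁻ t in Set.Ioo (0 : ℝ) T,
                  (ENNReal.ofReal (t ^ (-s)) * osc d N v Set.univ f x t) ^ q
                    * ENNReal.ofReal (1 / t)) ^ (1 / q)) := by
  obtain ⟨m, hm⟩ := exists_pow_lt_of_lt_one hT (by norm_num : (1 / 2 : ℝ) < 1)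
  have hmT : (2 : ℝ) ^ (-(m : ℝ)) ≤ T := by
    rw [Real.rpow_neg (by norm_num), Real.rpow_natCast, ← inv_pow, ← one_div]
    exact hm.le
  set κ := (s + (d : ℝ) / v) * q with hκ
  have hκ0 : 0 < κ := by positivity
  set K : ℝ := 1 + m * 2 ^ (m * κ) + 2 * 2 ^ κ with hK
  have hK0 : 0 < K := by positivity
  refine ⟨(K * 2) ^ (1 / q), by positivity, fun f _ x => ?_⟩
  set A := ∫⁻ y in Metric.ball x 1, (‖f y‖₊ : ℝ≥0∞) ^ v
  change _ ≤ _ * (_ + (∫⁻ t in Set.Ioo 0 T, oscIntegrand d N q v s f x t) ^ (1 / q))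
  set J := ∫⁻ t in Set.Ioo 0 T, oscIntegrand d N q v s f x t
  simp only [iInf_rpow_eq_polyError_rpow d N v f x _ (div_pos hq hv)]
  have hexp : ∀ j : ℕ, ((j : ℝ) + 1) * (s + (d : ℝ) / v) * q = (j + 1) * κ := fun j => by
    rw [hκ]; ring
  simp only [hexp]
  set a : ℕ → ℝ≥0∞ := fun j => ENNReal.ofReal ((2 : ℝ) ^ (((j : ℝ) + 1) * κ)) *
    polyError d N v f x (2 ^ (-((j : ℝ) + 1))) ^ (q / v) with ha
  have hhead : ∑ j ∈ Finset.range m, a j ≤ ENNReal.ofReal (m * 2 ^ (m * κ)) * A ^ (q / v) := by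
    have hj : ∀ j ∈ Finset.range m, a j ≤ ENNReal.ofReal (2 ^ (m * κ)) * A ^ (q / v) := by
      intro j hj
      have hjm : (j : ℝ) + 1 ≤ m := by exact_mod_cast Finset.mem_range.1 hj
      refine mul_le_mul' (ENNReal.ofReal_le_ofReal ?_) (ENNReal.rpow_le_rpow ?_ (by positivity))
      · exact Real.rpow_le_rpow_of_exponent_le (by norm_num) (by gcongr)
      · refine (polyError_mono d N v f x ?_).trans (polyError_le hN v f x 1)
        exact Real.rpow_le_one_of_one_le_of_nonpos (by norm_num) (by linarith [j.cast_nonneg (α := ℝ)])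
    refine (Finset.sum_le_card_nsmul _ _ _ hj).trans (le_of_eq ?_)
    rw [Finset.card_range, nsmul_eq_mul, ENNReal.ofReal_mul (by positivity),
      ENNReal.ofReal_natCast, mul_assoc]
  have htail : ∑' j, a (j + m) ≤ ENNReal.ofReal (2 * 2 ^ κ) * J := by
    refine le_trans ?_ (mul_le_mul_right (tsum_setLIntegral_dyadic_le _ hmT) _)
    rw [← ENNReal.tsum_mul_left]
    refine ENNReal.tsum_le_tsum fun j => ?_
    have h := polyError_le_setLIntegral_oscIntegrand d N hq hv hs f x
      (ρ := 2 ^ (-((j + m : ℕ) : ℝ))) (by positivity)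
    have hhalf : (2 : ℝ) ^ (-((j + m : ℕ) : ℝ)) / 2 = 2 ^ (-(((j + m : ℕ) : ℝ) + 1)) := by
      rw [neg_add, ← sub_eq_add_neg, Real.rpow_sub_one (by norm_num)]
    refine le_trans (le_of_eq ?_) h
    rw [hhalf, ← Real.rpow_mul (by norm_num), ← hκ, neg_mul_neg]
  have hsum : A ^ (q / v) + ∑' j, a j ≤ ENNReal.ofReal K * (A ^ (q / v) + J) := by
    rw [← ENNReal.summable.sum_add_tsum_nat_add' (k := m)]
    refine (add_le_add_right (add_le_add hhead htail) _).trans ?_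
    have h1 : ENNReal.ofReal K = 1 + ENNReal.ofReal (m * 2 ^ (m * κ)) +
        ENNReal.ofReal (2 * 2 ^ κ) := by
      rw [hK, ENNReal.ofReal_add (by positivity) (by positivity),
        ENNReal.ofReal_add (by positivity) (by positivity), ENNReal.ofReal_one]
    calc _ = (1 + ENNReal.ofReal (m * 2 ^ (m * κ))) * A ^ (q / v)
          + ENNReal.ofReal (2 * 2 ^ κ) * J := by ring
      _ ≤ ENNReal.ofReal K * A ^ (q / v) + ENNReal.ofReal K * J := by
        rw [h1]
        exact add_le_add (mul_le_mul_left le_self_add _) (mul_le_mul_left le_add_self _)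
      _ = _ := by ring
  have hA : A ^ (q / v) = (A ^ (1 / v)) ^ q := by
    rw [← ENNReal.rpow_mul]; congr 1; ring
  have hJ : J = (J ^ (1 / q)) ^ q := by
    rw [← ENNReal.rpow_mul, one_div_mul_cancel hq.ne', ENNReal.rpow_one]
  have hfin : A ^ (q / v) + J ≤ 2 * (A ^ (1 / v) + J ^ (1 / q)) ^ q := by
    rw [two_mul]
    refine add_le_add ?_ ?_
    · rw [hA]; exact ENNReal.rpow_le_rpow le_self_add hq.le
    · conv_lhs => rw [hJ]
      exact ENNReal.rpow_le_rpow le_add_self hq.le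
  calc _ ≤ (ENNReal.ofReal (K * 2) * (A ^ (1 / v) + J ^ (1 / q)) ^ q) ^ (1 / q) := by
        refine ENNReal.rpow_le_rpow (hsum.trans ?_) (by positivity)
        rw [ENNReal.ofReal_mul hK0.le, ENNReal.ofReal_ofNat, mul_assoc]
        exact mul_le_mul_right hfin _
    _ = _ := by
        rw [ENNReal.mul_rpow_of_nonneg _ _ (by positivity), ← ENNReal.rpow_mul,
          mul_one_div_cancel hq.ne', ENNReal.rpow_one, ENNReal.ofReal_rpow_of_pos (by positivity)]
end
end
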